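/- arXiv:2406.07273 — 7 statements merged into one kernel-verified Lean document; each statement's English description precedes it below -/
import Mathlib

section
/- There exists an infinite-dimensional real Banach space X such that (i) whenever f, g ∈ NA(X,ℝ) are linearly independent and 0 < t < 1, the functional t·f + (1−t)·g is not norm-attaining, and (ii) for every closed linear subspace M of X with dim(X/M) = 2 there exist x₁, x₂ ∈ X such that the set {π_M(x) : x ∈ X \ M and there exists m ∈ M with ‖x − m‖ = dist(x, M)} is contained in ℝ·π_M(x₁) ∪ ℝ·π_M(x₂), where π_M : X → X/M is the quotient map. -/
open Filter Topology

section InfimalNorm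

variable {E H : Type*} [NormedAddCommGroup E] [NormedSpace ℝ E]
  [NormedAddCommGroup H] [InnerProductSpace ℝ H]

/-- `f` is a subgradient of the seminorm `p` at `x`. -/
def Supports (p : Seminorm ℝ E) (f : E →L[ℝ] ℝ) (x : E) : Prop :=
  (∀ y, f y ≤ p y) ∧ f x = p x

/-- The seminorm whose open unit ball is the sum of the open unit ball of `E` and the image under
`i` of that of `H`. -/
noncomputable def infimalNorm (i : H →L[ℝ] E) : Seminorm ℝ E :=
  (normSeminorm ℝ ((E × H) ⧸ LinearMap.range ((-i : H →L[ℝ] E).prod (.id ℝ H)).toLinearMap)).comp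
    ((Submodule.mkQ _).comp (LinearMap.inl ℝ E H))

theorem infimalNorm_add_le (i : H →L[ℝ] E) (y : E) (z : H) :
    infimalNorm i (y + i z) ≤ max ‖y‖ ‖z‖ := by
  set N := LinearMap.range ((-i : H →L[ℝ] E).prod (.id ℝ H)).toLinearMap
  have h : (Submodule.Quotient.mk (y + i z, 0) : (E × H) ⧸ N) = Submodule.Quotient.mk (y, z) := by
    rw [Submodule.Quotient.eq]
    exact ⟨-z, by simp⟩
  change ‖(Submodule.Quotient.mk (y + i z, 0) : (E × H) ⧸ N)‖ ≤ _
  rw [h]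
  exact Submodule.Quotient.norm_mk_le N (y, z)

theorem exists_add_eq_of_infimalNorm_lt (i : H →L[ℝ] E) {x : E} {r : ℝ}
    (hr : infimalNorm i x < r) : ∃ y z, y + i z = x ∧ ‖y‖ < r ∧ ‖z‖ < r := by
  set N := LinearMap.range ((-i : H →L[ℝ] E).prod (.id ℝ H)).toLinearMap
  obtain ⟨⟨y, z⟩, hyz, hlt⟩ := Submodule.Quotient.norm_mk_lt
    (Submodule.Quotient.mk (x, 0) : (E × H) ⧸ N) (sub_pos.2 hr)
  rw [Submodule.Quotient.eq] at hyz
  obtain ⟨w, hw⟩ := hyz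
  have hlt' : ‖(y, z)‖ < r := by
    have : ‖(Submodule.Quotient.mk (x, 0) : (E × H) ⧸ N)‖ = infimalNorm i x := rfl
    linarith
  have h1 : -i w = y - x := congrArg Prod.fst hw
  have h2 : w = z := by simpa using congrArg Prod.snd hw
  refine ⟨y, z, ?_, (norm_fst_le (y, z)).trans_lt hlt', (norm_snd_le (y, z)).trans_lt hlt'⟩
  have h3 : y = x + -i w := by rw [h1]; abel
  rw [← h2, h3]
  abel

theorem infimalNorm_le_norm (i : H →L[ℝ] E) (x : E) : infimalNorm i x ≤ ‖x‖ := by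
  simpa using infimalNorm_add_le i x 0

theorem norm_le_infimalNorm (i : H →L[ℝ] E) (x : E) : ‖x‖ ≤ (1 + ‖i‖) * infimalNorm i x := by
  have h : ∀ r, infimalNorm i x < r → ‖x‖ ≤ (1 + ‖i‖) * r := fun r hr ↦ by
    obtain ⟨y, z, rfl, hy, hz⟩ := exists_add_eq_of_infimalNorm_lt i hr
    calc ‖y + i z‖ ≤ ‖y‖ + ‖i‖ * ‖z‖ := (norm_add_le _ _).trans (by gcongr; exact i.le_opNorm z)
      _ ≤ r + ‖i‖ * r := by gcongr
      _ = _ := by ring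
  have hlim : Tendsto (fun r ↦ (1 + ‖i‖) * r) (𝓝[>] (infimalNorm i x))
      (𝓝 ((1 + ‖i‖) * infimalNorm i x)) :=
    ((continuous_const_mul _).tendsto _).mono_left nhdsWithin_le_nhds
  exact ge_of_tendsto hlim (eventually_mem_nhdsWithin.mono h)

/-- A subgradient of the infimal norm at a unit vector `x` splits `x` as a sum of a unit vector of
`E` and the image of a unit vector of `H`, each of them maximising the functional. -/
theorem Supports.exists_decomposition [CompleteSpace H] {i : H →L[ℝ] E} (hi : DenseRange i)
    {u : E →L[ℝ] ℝ} {x : E} (hu : Supports (infimalNorm i) u x) (hx : infimalNorm i x = 1) :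
    ∃ ρ : H, ∃ b > 0, ‖ρ‖ = 1 ∧ (∀ z, u (i z) = b * inner ℝ ρ z) ∧ ‖x - i ρ‖ ≤ 1 ∧
      ∀ y, ‖y‖ ≤ 1 → u y ≤ u (x - i ρ) := by
  set r := (InnerProductSpace.toDual ℝ H).symm (u.comp i)
  have hr : ∀ z, u (i z) = inner ℝ r z := fun z ↦ by simp [r]
  have hux : u x = 1 := hu.2.trans hx
  have hr0 : r ≠ 0 := by
    intro h0
    have : (u : E → ℝ) = 0 := hi.equalizer u.continuous continuous_const
      (funext fun z ↦ by simp [hr, h0])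
    rw [this] at hux
    simp at hux
  have hb : 0 < ‖r‖ := norm_pos_iff.2 hr0
  set b := ‖r‖
  set ρ := b⁻¹ • r
  have hρ : ‖ρ‖ = 1 := by simp [ρ, norm_smul, b, hr0]
  have hrρ : r = b • ρ := by simp [ρ, hb.ne']
  have hur : ∀ z, u (i z) = b * inner ℝ ρ z := fun z ↦ by
    rw [hr, hrρ, real_inner_smul_left]
  have huρ : u (i ρ) = b := by rw [hur, real_inner_self_eq_norm_sq, hρ]; simp
  have hy : ∀ y, ‖y‖ ≤ 1 → u y ≤ 1 - b := fun y hy ↦ by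
    have := (hu.1 (y + i ρ)).trans (infimalNorm_add_le i y ρ)
    rw [map_add, huρ, hρ, max_eq_right hy] at this
    linarith
  refine ⟨ρ, b, hb, hρ, hur, ?_, fun y h ↦ by rw [map_sub, hux, huρ]; exact hy y h⟩
  have key : ∀ ε > 0, ‖x - i ρ‖ ≤ 1 + ε + ‖i‖ * √(2 * ε + ε ^ 2 + 2 * ε / b) := fun ε hε ↦ by
    obtain ⟨y, z, hyz, hny, hnz⟩ := exists_add_eq_of_infimalNorm_lt i
      (show infimalNorm i x < 1 + ε by linarith)
    have h1 : u y ≤ (1 + ε) * (1 - b) := by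
      have h := hy ((1 + ε)⁻¹ • y) (by
        rw [norm_smul, norm_inv, Real.norm_of_nonneg (by positivity),
          inv_mul_le_iff₀ (by positivity)]
        linarith)
      rwa [map_smul, smul_eq_mul, inv_mul_le_iff₀ (by positivity)] at h
    have h2 : u y + b * inner ℝ ρ z = 1 := by rw [← hur, ← map_add, hyz, hux]
    have h3 : 1 - ε / b ≤ inner ℝ ρ z := by
      rw [sub_le_iff_le_add, ← sub_le_iff_le_add', le_div_iff₀ hb]
      nlinarith
    have h4 : ‖z - ρ‖ ≤ √(2 * ε + ε ^ 2 + 2 * ε / b) := by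
      apply Real.le_sqrt_of_sq_le
      rw [norm_sub_sq_real, hρ, real_inner_comm]
      have : ‖z‖ ^ 2 ≤ (1 + ε) ^ 2 := by gcongr
      have : 2 * ε / b = 2 * (ε / b) := by ring
      nlinarith
    have h5 : x - i ρ = y + i (z - ρ) := by rw [map_sub, ← hyz]; abel
    rw [h5]
    refine (norm_add_le _ _).trans (add_le_add hny.le ((i.le_opNorm _).trans ?_))
    gcongr
  have hlim : Tendsto (fun ε : ℝ ↦ 1 + ε + ‖i‖ * √(2 * ε + ε ^ 2 + 2 * ε / b)) (𝓝[>] 0) (𝓝 1) := by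
    have : Continuous (fun ε : ℝ ↦ 1 + ε + ‖i‖ * √(2 * ε + ε ^ 2 + 2 * ε / b)) := by fun_prop
    simpa using (this.tendsto 0).mono_left nhdsWithin_le_nhds
  exact ge_of_tendsto hlim (eventually_mem_nhdsWithin.mono key)

theorem Supports.pos_smul {p : Seminorm ℝ E} {u : E →L[ℝ] ℝ} {x : E} (h : Supports p u x)
    {t : ℝ} (ht : 0 ≤ t) : Supports p u (t • x) :=
  ⟨h.1, by simp [h.2, map_smul_eq_mul, abs_of_nonneg ht]⟩

theorem Supports.neg {p : Seminorm ℝ E} {u : E →L[ℝ] ℝ} {x : E} (h : Supports p u x) :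
    Supports p (-u) (-x) :=
  ⟨fun y ↦ by simpa using h.1 (-y), by simpa [map_neg_eq_map] using h.2⟩

/-- The infimal norm is smooth. -/
theorem Supports.unique [CompleteSpace H] {i : H →L[ℝ] E} (hi : DenseRange i)
    {u v : E →L[ℝ] ℝ} {x : E} (hu : Supports (infimalNorm i) u x)
    (hv : Supports (infimalNorm i) v x) (hx : infimalNorm i x = 1) : u = v := by
  obtain ⟨ρ, b, hb, hρ, hur, hxρ, -⟩ := hu.exists_decomposition hi hx
  obtain ⟨σ, c, hc, hσ, hvr, -, hmax⟩ := hv.exists_decomposition hi hx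
  have h1 := hmax _ hxρ
  rw [map_sub, map_sub, sub_le_sub_iff_left, hvr, hvr, mul_le_mul_iff_right₀ hc,
    real_inner_self_eq_norm_sq, hσ] at h1
  have h2 : σ = ρ := by
    rw [← inner_eq_one_iff_of_norm_eq_one (𝕜 := ℝ) hσ hρ]
    exact le_antisymm ((real_inner_le_norm σ ρ).trans (by simp [hσ, hρ])) (by simpa using h1)
  subst h2
  have h3 : ∀ y, b * v y = c * u y := congrFun <| hi.equalizer (g := fun y ↦ b * v y)
    (h := fun y ↦ c * u y) (by fun_prop) (by fun_prop)
    (funext fun z ↦ by simp only [Function.comp, hur, hvr]; ring)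
  have h4 := h3 x
  rw [hu.2, hv.2, hx, mul_one, mul_one] at h4
  ext y
  have := h3 y
  rw [h4] at this
  exact (mul_left_cancel₀ hc.ne' this).symm

end InfimalNorm

section Directions

variable {E H : Type*} [NormedAddCommGroup E] [NormedSpace ℝ E]
  [NormedAddCommGroup H] [InnerProductSpace ℝ H]

theorem summable_norm_apply {T : ℕ → E →L[ℝ] H} (hT : Summable fun k ↦ ‖T k‖) (x : E) :
    Summable fun k ↦ ‖T k x‖ :=
  .of_nonneg_of_le (fun _ ↦ norm_nonneg _) (fun k ↦ (T k).le_opNorm x) (hT.mul_right ‖x‖)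

/-- The seminorm `x ↦ ∑ₖ ‖Tₖ x‖`. -/
noncomputable def sumNorm (T : ℕ → E →L[ℝ] H) (hT : Summable fun k ↦ ‖T k‖) : Seminorm ℝ E :=
  Seminorm.of (fun x ↦ ∑' k, ‖T k x‖)
    (fun x y ↦ by
      rw [← (summable_norm_apply hT x).tsum_add (summable_norm_apply hT y)]
      refine (summable_norm_apply hT _).tsum_le_tsum (fun k ↦ ?_)
        ((summable_norm_apply hT x).add (summable_norm_apply hT y))
      rw [map_add]
      exact norm_add_le _ _)
    (fun a x ↦ by simp [norm_smul, tsum_mul_left])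

theorem sumNorm_apply (T : ℕ → E →L[ℝ] H) (hT : Summable fun k ↦ ‖T k‖) (x : E) :
    sumNorm T hT x = ∑' k, ‖T k x‖ := rfl

theorem sumNorm_le (T : ℕ → E →L[ℝ] H) (hT : Summable fun k ↦ ‖T k‖) (x : E) :
    sumNorm T hT x ≤ (∑' k, ‖T k‖) * ‖x‖ := by
  rw [sumNorm_apply, ← tsum_mul_right]
  exact (summable_norm_apply hT x).tsum_le_tsum (fun k ↦ (T k).le_opNorm x) (hT.mul_right _)

/-- The normalisation of a vector. -/
noncomputable def direction (h : H) : H := ‖h‖⁻¹ • h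

theorem norm_direction_le (h : H) : ‖direction h‖ ≤ 1 := by
  rw [direction, norm_smul, norm_inv, norm_norm]
  exact inv_mul_le_one

theorem norm_direction {h : H} (hh : h ≠ 0) : ‖direction h‖ = 1 := by
  simp [direction, norm_smul, hh]

theorem inner_direction_self (h : H) : inner ℝ (direction h) h = ‖h‖ := by
  rw [direction, real_inner_smul_left, real_inner_self_eq_norm_sq]
  by_cases hh : ‖h‖ = 0
  · simp [hh]
  · field_simp

theorem norm_smul_direction (h : H) : ‖h‖ • direction h = h := by
  by_cases hh : h = 0
  · simp [hh]
  · simp [direction, hh]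

theorem inner_direction_le (h g : H) : inner ℝ (direction h) g ≤ ‖g‖ :=
  (real_inner_le_norm _ _).trans
    (mul_le_of_le_one_left (norm_nonneg _) (norm_direction_le h))

theorem continuousAt_direction {h : H} (hh : h ≠ 0) : ContinuousAt (direction : H → H) h := by
  unfold direction
  exact (continuousAt_id.norm.inv₀ (by simpa using hh)).smul continuousAt_id

theorem direction_smul (c : ℝ) (h : H) :
    direction (c • h) = (SignType.sign c : ℝ) • direction h := by
  rcases lt_trichotomy c 0 with hc | rfl | hc
  · simp [direction, norm_smul, abs_of_neg hc, sign_neg hc, smul_smul, hc.ne]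
  · simp [direction]
  · simp [direction, norm_smul, abs_of_pos hc, sign_pos hc, smul_smul, hc.ne']

theorem summable_inner_direction {T : ℕ → E →L[ℝ] H} (hT : Summable fun k ↦ ‖T k‖) (x : E) :
    Summable fun k ↦ (innerSL ℝ (direction (T k x))).comp (T k) := by
  refine .of_norm_bounded hT fun k ↦ (ContinuousLinearMap.opNorm_comp_le _ _).trans ?_
  rw [innerSL_apply_norm]
  exact mul_le_of_le_one_left (norm_nonneg _) (norm_direction_le _)

/-- The gradient at `x` of `sumNorm T`, as soon as no `T k x` vanishes. -/
noncomputable def sumNormGradient (T : ℕ → E →L[ℝ] H) (x : E) : E →L[ℝ] ℝ :=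
  ∑' k, (innerSL ℝ (direction (T k x))).comp (T k)

theorem hasSum_sumNormGradient {T : ℕ → E →L[ℝ] H} (hT : Summable fun k ↦ ‖T k‖) (x y : E) :
    HasSum (fun k ↦ inner ℝ (direction (T k x)) (T k y)) (sumNormGradient T x y) := by
  have h := (summable_inner_direction hT x).hasSum.mapL (ContinuousLinearMap.apply ℝ ℝ y)
  simp only [ContinuousLinearMap.apply_apply, ContinuousLinearMap.comp_apply,
    innerSL_apply_apply] at h
  exact h

theorem Supports.sub_sumNormGradient {p : Seminorm ℝ E} {T : ℕ → E →L[ℝ] H}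
    {hT : Summable fun k ↦ ‖T k‖} {f : E →L[ℝ] ℝ} {x : E} (hf : Supports (p + sumNorm T hT) f x)
    (hx : ∀ k, T k x ≠ 0) : Supports p (f - sumNormGradient T x) x := by
  refine ⟨fun y ↦ ?_, ?_⟩
  · have hlim : Tendsto (fun t : ℝ ↦ sumNormGradient T (x + t • y) y) (𝓝[>] 0)
        (𝓝 (sumNormGradient T x y)) := by
      have hs := fun z ↦ (hasSum_sumNormGradient hT z y).tsum_eq
      simp_rw [← hs]
      refine tendsto_tsum_of_dominated_convergence (summable_norm_apply hT y) (fun k ↦ ?_)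
        (.of_forall fun t k ↦ ?_)
      · have h1 : Tendsto (fun t : ℝ ↦ T k (x + t • y)) (𝓝 0) (𝓝 (T k x)) := by
          have : Continuous fun t : ℝ ↦ T k (x + t • y) := by fun_prop
          simpa using this.tendsto 0
        exact (((continuousAt_direction (hx k)).tendsto.comp h1).inner tendsto_const_nhds).mono_left
          nhdsWithin_le_nhds
      · exact (norm_inner_le_norm _ _).trans
          (mul_le_of_le_one_left (norm_nonneg _) (norm_direction_le _))
    have hle : ∀ t > (0 : ℝ), f y - p y ≤ sumNormGradient T (x + t • y) y := fun t ht ↦ by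
      have h1 := hf.1 (x + t • y)
      have h2 := hf.2
      have h3 : p (x + t • y) ≤ p x + t * p y :=
        (map_add_le_add p _ _).trans (by simp [map_smul_eq_mul, abs_of_pos ht])
      have h4 : sumNorm T hT (x + t • y) ≤
          sumNorm T hT x + t * sumNormGradient T (x + t • y) y := by
        have hsum := (summable_norm_apply hT x).hasSum.add
          ((hasSum_sumNormGradient hT (x + t • y) y).mul_left t)
        refine hasSum_le (fun k ↦ ?_) (summable_norm_apply hT _).hasSum hsum
        have := inner_direction_le (T k (x + t • y)) (T k x)
        rw [← inner_direction_self (T k (x + t • y))]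
        nth_rw 2 [map_add]
        rw [inner_add_right, map_smul, real_inner_smul_right]
        linarith
      simp only [add_apply, map_add, map_smul, smul_eq_mul] at h1 h2
      nlinarith
    have := ge_of_tendsto hlim (eventually_mem_nhdsWithin.mono hle)
    rw [sub_apply]
    linarith
  · have h1 : sumNormGradient T x x = sumNorm T hT x :=
      (hasSum_sumNormGradient hT x x).unique
        (by simpa only [inner_direction_self, sumNorm_apply] using
          (summable_norm_apply hT x).hasSum)
    simp [hf.2, h1]

/-- The properties of a smooth seminorm `p` and a sequence of operators `T` under which no
three pairwise independent functionals attaining the norm `p + ∑ₖ ‖Tₖ ·‖` are coplanar. -/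
structure Admissible (p : Seminorm ℝ E) (T : ℕ → E →L[ℝ] H) (Z : Submodule ℝ (E →L[ℝ] ℝ)) :
    Prop where
  summable : Summable fun k ↦ ‖T k‖
  injective : ∀ k, Function.Injective (T k)
  tendsto_inner : ∀ x y, x ≠ 0 → y ≠ 0 →
    Tendsto (fun k ↦ |inner ℝ (direction (T k x)) (direction (T k y))|) atTop (𝓝 1)
  mem_of_supports : ∀ u x, Supports p u x → x ≠ 0 → u ∈ Z
  unique : ∀ u v x, Supports p u x → Supports p v x → x ≠ 0 → u = v
  independent : ∀ (d : ℕ → H) (C : ℝ) (g : E →L[ℝ] ℝ), (∀ k, ‖d k‖ ≤ C) → g ∈ Z →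
    (∀ y, HasSum (fun k ↦ inner ℝ (d k) (T k y)) (g y)) → ∀ k, d k = 0

namespace Admissible

variable {p : Seminorm ℝ E} {T : ℕ → E →L[ℝ] H} {Z : Submodule ℝ (E →L[ℝ] ℝ)}

theorem apply_ne_zero (h : Admissible p T Z) {x : E} (hx : x ≠ 0) (k : ℕ) : T k x ≠ 0 :=
  fun h0 ↦ hx (h.injective k (by simpa using h0))

theorem direction_relation (h : Admissible p T Z) {f₁ f₂ f₃ : E →L[ℝ] ℝ} {x₁ x₂ x₃ : E}
    (h₁ : Supports (p + sumNorm T h.summable) f₁ x₁) (hx₁ : x₁ ≠ 0)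
    (h₂ : Supports (p + sumNorm T h.summable) f₂ x₂) (hx₂ : x₂ ≠ 0)
    (h₃ : Supports (p + sumNorm T h.summable) f₃ x₃) (hx₃ : x₃ ≠ 0) {a b c : ℝ}
    (hf : a • f₁ + b • f₂ = c • f₃) (k : ℕ) :
    a • direction (T k x₁) + b • direction (T k x₂) = c • direction (T k x₃) := by
  have m₁ := h.mem_of_supports _ _ (h₁.sub_sumNormGradient (h.apply_ne_zero hx₁)) hx₁
  have m₂ := h.mem_of_supports _ _ (h₂.sub_sumNormGradient (h.apply_ne_zero hx₂)) hx₂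
  have m₃ := h.mem_of_supports _ _ (h₃.sub_sumNormGradient (h.apply_ne_zero hx₃)) hx₃
  have hg : a • sumNormGradient T x₁ + b • sumNormGradient T x₂ - c • sumNormGradient T x₃ ∈ Z := by
    have := Z.sub_mem (Z.smul_mem c m₃) (Z.add_mem (Z.smul_mem a m₁) (Z.smul_mem b m₂))
    convert this using 1
    simp only [smul_sub, ← hf]
    abel
  rw [← sub_eq_zero]
  refine h.independent (fun k ↦ a • direction (T k x₁) + b • direction (T k x₂) -
    c • direction (T k x₃)) (|a| * 1 + |b| * 1 + |c| * 1) _ (fun k ↦ ?_) hg (fun y ↦ ?_) k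
  · refine (norm_sub_le _ _).trans (add_le_add ((norm_add_le _ _).trans ?_) ?_)
    all_goals simp only [norm_smul, Real.norm_eq_abs]
    · gcongr <;> exact norm_direction_le _
    · gcongr; exact norm_direction_le _
  · simpa [inner_add_left, inner_sub_left, real_inner_smul_left] using
      (((hasSum_sumNormGradient h.summable x₁ y).mul_left a).add
        ((hasSum_sumNormGradient h.summable x₂ y).mul_left b)).sub
        ((hasSum_sumNormGradient h.summable x₃ y).mul_left c)

theorem exists_eq_smul (h : Admissible p T Z) {f₁ f₂ f₃ : E →L[ℝ] ℝ} {x₁ x₂ x₃ : E}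
    (h₁ : Supports (p + sumNorm T h.summable) f₁ x₁) (hx₁ : x₁ ≠ 0)
    (h₂ : Supports (p + sumNorm T h.summable) f₂ x₂) (hx₂ : x₂ ≠ 0)
    (h₃ : Supports (p + sumNorm T h.summable) f₃ x₃) (hx₃ : x₃ ≠ 0) {a b c : ℝ}
    (ha : a ≠ 0) (hb : b ≠ 0) (hf : a • f₁ + b • f₂ = c • f₃) : ∃ s : ℝ, x₁ = s • x₂ := by
  have hn : ∀ {x}, x ≠ 0 → ∀ k, ‖direction (T k x)‖ = 1 := fun hx k ↦
    norm_direction (h.apply_ne_zero hx k)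
  have hconst : ∀ k, inner ℝ (direction (T k x₁)) (direction (T k x₂)) =
      (c ^ 2 - a ^ 2 - b ^ 2) / (2 * a * b) := fun k ↦ by
    have hk := congrArg (fun v ↦ ‖v‖ ^ 2) (h.direction_relation h₁ hx₁ h₂ hx₂ h₃ hx₃ hf k)
    simp only [norm_add_sq_real, norm_smul, hn hx₁, hn hx₂, hn hx₃, real_inner_smul_left,
      real_inner_smul_right, Real.norm_eq_abs, mul_one, sq_abs] at hk
    field_simp
    linarith
  have habs : |inner ℝ (direction (T 0 x₁)) (direction (T 0 x₂))| = 1 := by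
    refine tendsto_nhds_unique ?_ (h.tendsto_inner x₁ x₂ hx₁ hx₂)
    simp_rw [hconst]
    exact tendsto_const_nhds
  have hpar : ∃ r : ℝ, direction (T 0 x₁) = r • direction (T 0 x₂) := by
    rcases eq_or_eq_neg_of_abs_eq habs with h1 | h1
    · exact ⟨1, by
        rw [one_smul]
        exact (inner_eq_one_iff_of_norm_eq_one (hn hx₁ 0) (hn hx₂ 0)).1 h1⟩
    · refine ⟨-1, ?_⟩
      rw [neg_one_smul]
      refine (inner_eq_one_iff_of_norm_eq_one (𝕜 := ℝ) (hn hx₁ 0) (by rw [norm_neg, hn hx₂ 0])).1 ?_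
      rw [inner_neg_right, h1, neg_neg]
  obtain ⟨r, hr⟩ := hpar
  refine ⟨‖T 0 x₁‖ * r * ‖T 0 x₂‖⁻¹, h.injective 0 ?_⟩
  calc T 0 x₁ = ‖T 0 x₁‖ • direction (T 0 x₁) := (norm_smul_direction _).symm
    _ = T 0 ((‖T 0 x₁‖ * r * ‖T 0 x₂‖⁻¹) • x₂) := by
      rw [hr, map_smul, direction, smul_smul, smul_smul]

theorem eq_or_eq_neg (h : Admissible p T Z) {f g : E →L[ℝ] ℝ} {x : E} {s : ℝ}
    (hf : Supports (p + sumNorm T h.summable) f (s • x))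
    (hg : Supports (p + sumNorm T h.summable) g x) (hx : x ≠ 0) (hs : s ≠ 0) :
    f = g ∨ f = -g := by
  have huniq : ∀ {f g : E →L[ℝ] ℝ}, Supports (p + sumNorm T h.summable) f x →
      Supports (p + sumNorm T h.summable) g x → f = g := fun hf hg ↦ by
    simpa using h.unique _ _ x (hf.sub_sumNormGradient (h.apply_ne_zero hx))
      (hg.sub_sumNormGradient (h.apply_ne_zero hx)) hx
  rcases hs.lt_or_gt with hs | hs
  · right
    rw [← huniq (f := -f) (g := g) ?_ hg, neg_neg]
    have := hf.neg.pos_smul (t := -s⁻¹) (by simpa using hs.le)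
    rwa [neg_smul_neg, smul_smul, inv_mul_cancel₀ hs.ne, one_smul] at this
  · left
    refine huniq ?_ hg
    have := hf.pos_smul (t := s⁻¹) (by positivity)
    rwa [smul_smul, inv_mul_cancel₀ hs.ne', one_smul] at this

end Admissible

end Directions

section NuclearSum

variable {F G : Type*} [NormedAddCommGroup F] [NormedSpace ℝ F]
  [NormedAddCommGroup G] [NormedSpace ℝ G]

/-- The operator `x ↦ ∑ₙ wₙ φₙ(x) eₙ`. -/
noncomputable def nuclearSum (w : ℕ → ℝ) (φ : ℕ → F →L[ℝ] ℝ) (e : ℕ → G) : F →L[ℝ] G :=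
  ∑' n, w n • (φ n).smulRight (e n)

variable {w : ℕ → ℝ} {φ : ℕ → F →L[ℝ] ℝ} {e : ℕ → G} {C : ℝ}

theorem norm_nuclearSum_term_le (hφ : ∀ n, ‖φ n‖ ≤ C) (he : ∀ n, ‖e n‖ ≤ 1) (n : ℕ) :
    ‖w n • (φ n).smulRight (e n)‖ ≤ |w n| * C := by
  rw [norm_smul, ContinuousLinearMap.norm_smulRight_apply, Real.norm_eq_abs]
  have : 0 ≤ C := (norm_nonneg _).trans (hφ n)
  gcongr
  exact (mul_le_of_le_one_right (norm_nonneg _) (he n)).trans (hφ n)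

theorem norm_nuclearSum_le (hw : Summable w) (hφ : ∀ n, ‖φ n‖ ≤ C) (he : ∀ n, ‖e n‖ ≤ 1) :
    ‖nuclearSum w φ e‖ ≤ (∑' n, |w n|) * C :=
  tsum_of_norm_bounded (hw.abs.hasSum.mul_right C) (norm_nuclearSum_term_le hφ he)

theorem hasSum_nuclearSum [CompleteSpace G] (hw : Summable w) (hφ : ∀ n, ‖φ n‖ ≤ C)
    (he : ∀ n, ‖e n‖ ≤ 1) (x : F) :
    HasSum (fun n ↦ (w n * φ n x) • e n) (nuclearSum w φ e x) := by
  have h := (Summable.of_norm_bounded (hw.abs.mul_right C)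
    (norm_nuclearSum_term_le hφ he)).hasSum.mapL (ContinuousLinearMap.apply ℝ G x)
  simp only [ContinuousLinearMap.apply_apply, smul_apply, ContinuousLinearMap.smulRight_apply,
    smul_smul] at h
  exact h

end NuclearSum

section NullSequences

open scoped ZeroAtInfty

namespace ZeroAtInftyContinuousMap

theorem norm_le_iff_forall {x : C₀(ℕ, ℝ)} {C : ℝ} (hC : 0 ≤ C) : ‖x‖ ≤ C ↔ ∀ n, |x n| ≤ C := by
  rw [← norm_toBCF_eq_norm, BoundedContinuousFunction.norm_le hC]
  rfl

theorem abs_apply_le_norm (x : C₀(ℕ, ℝ)) (n : ℕ) : |x n| ≤ ‖x‖ :=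
  (norm_le_iff_forall (norm_nonneg x)).1 le_rfl n

theorem tendsto_atTop (x : C₀(ℕ, ℝ)) : Tendsto x atTop (𝓝 0) := by
  have h := x.zero_at_infty'
  rwa [Filter.cocompact_eq_cofinite, Nat.cofinite_eq_atTop] at h

/-- The `n`-th unit vector of `c₀`. -/
noncomputable def unitVec (n : ℕ) : C₀(ℕ, ℝ) where
  toFun m := if m = n then 1 else 0
  continuous_toFun := continuous_of_discreteTopology
  zero_at_infty' := by
    rw [Filter.cocompact_eq_cofinite, Nat.cofinite_eq_atTop]
    refine tendsto_const_nhds.congr' ?_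
    filter_upwards [eventually_gt_atTop n] with m hm
    simp [hm.ne']

theorem unitVec_apply (n m : ℕ) : unitVec n m = if m = n then 1 else 0 := rfl

theorem norm_unitVec_le (n : ℕ) : ‖unitVec n‖ ≤ 1 := by
  rw [norm_le_iff_forall zero_le_one]
  intro m
  rw [unitVec_apply]
  split_ifs <;> simp

/-- The evaluation functionals. -/
noncomputable def coord (n : ℕ) : C₀(ℕ, ℝ) →L[ℝ] ℝ :=
  LinearMap.mkContinuous ⟨⟨fun x ↦ x n, fun _ _ ↦ rfl⟩, fun _ _ ↦ rfl⟩ 1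
    (fun x ↦ by simpa using abs_apply_le_norm x n)

theorem coord_apply (n : ℕ) (x : C₀(ℕ, ℝ)) : coord n x = x n := rfl

theorem norm_coord_le (n : ℕ) : ‖coord n‖ ≤ 1 := LinearMap.mkContinuous_norm_le _ zero_le_one _

theorem tendsto_sum_smul_unitVec (x : C₀(ℕ, ℝ)) :
    Tendsto (fun N ↦ ∑ n ∈ Finset.range N, x n • unitVec n) atTop (𝓝 x) := by
  rw [Metric.tendsto_atTop]
  intro ε hε
  obtain ⟨N, hN⟩ := (Metric.tendsto_atTop.1 (tendsto_atTop x)) (ε / 2) (half_pos hε)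
  refine ⟨N, fun M hM ↦ lt_of_le_of_lt ?_ (half_lt_self hε)⟩
  rw [dist_eq_norm, norm_le_iff_forall (half_pos hε).le]
  intro m
  have h : (∑ n ∈ Finset.range M, x n • unitVec n) m = if m < M then x m else 0 := by
    rw [← coord_apply, map_sum]
    simp [coord_apply, unitVec_apply]
  rw [sub_apply, h]
  split_ifs with hm
  · simpa using (half_pos hε).le
  · simpa using (hN m (hM.trans (not_lt.1 hm))).le

theorem linearIndependent_unitVec : LinearIndependent ℝ unitVec := by
  rw [linearIndependent_iff']
  intro s g hg i hi
  have := congrArg (coord i) hg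
  simpa [coord_apply, unitVec_apply, hi] using this

theorem not_finiteDimensional : ¬ FiniteDimensional ℝ C₀(ℕ, ℝ) := fun _ ↦
  (linearIndependent_unitVec.finite).false

/-- A functional attaining its maximum over the unit ball of `c₀` is finitely supported. -/
theorem eventually_apply_unitVec_eq_zero {u : C₀(ℕ, ℝ) →L[ℝ] ℝ} {y : C₀(ℕ, ℝ)} (hy : ‖y‖ ≤ 1)
    (hu : ∀ z, ‖z‖ ≤ 1 → u z ≤ u y) : ∀ᶠ n in atTop, u (unitVec n) = 0 := by
  have hsmall : ∀ᶠ n in atTop, |y n| < 1 / 2 := by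
    simpa using (tendsto_atTop y).abs.eventually (gt_mem_nhds (by norm_num : |(0 : ℝ)| < 1 / 2))
  filter_upwards [hsmall] with n hn
  have hball : ∀ s : ℝ, |s| ≤ 1 / 2 → s * u (unitVec n) ≤ 0 := fun s hs ↦ by
    have h := hu (y + s • unitVec n) ((norm_le_iff_forall zero_le_one).2 fun m ↦ ?_)
    · simpa using h
    · rw [add_apply, smul_apply, unitVec_apply]
      split_ifs with hm
      · subst hm
        refine (abs_add_le _ _).trans ?_
        simp only [smul_eq_mul, mul_one]
        linarith
      · simpa using (abs_apply_le_norm y m).trans hy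
  have h1 := hball (1 / 2) (by norm_num)
  have h2 := hball (-1 / 2) (by norm_num)
  linarith

end ZeroAtInftyContinuousMap

open ZeroAtInftyContinuousMap

variable {H : Type*} [NormedAddCommGroup H] [InnerProductSpace ℝ H]

/-- The diagonal operator from a Hilbert space to `c₀`. -/
noncomputable def diagonalMap (b : HilbertBasis ℕ ℝ H) : H →L[ℝ] C₀(ℕ, ℝ) :=
  nuclearSum (fun n ↦ (1 / 2 : ℝ) ^ n) (fun n ↦ innerSL ℝ (b n)) unitVec

theorem diagonalMap_apply_basis (b : HilbertBasis ℕ ℝ H) (n : ℕ) :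
    diagonalMap b (b n) = (1 / 2 : ℝ) ^ n • unitVec n := by
  have h := hasSum_nuclearSum (φ := fun n ↦ innerSL ℝ (b n)) (C := 1) (e := unitVec)
    summable_geometric_two (fun n ↦ by simp [b.orthonormal.1 n]) norm_unitVec_le (b n)
  refine h.unique ?_
  convert hasSum_single n fun m hm ↦ ?_ using 1
  · simp [b.orthonormal.1 n]
  · simp [b.orthonormal.2 hm]

theorem denseRange_diagonalMap (b : HilbertBasis ℕ ℝ H) : DenseRange (diagonalMap b) := by
  intro x
  refine mem_closure_of_tendsto (tendsto_sum_smul_unitVec x) (.of_forall fun N ↦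
    ⟨∑ n ∈ Finset.range N, (x n * 2 ^ n) • b n, ?_⟩)
  simp [diagonalMap_apply_basis, smul_smul]

/-- The functionals on `c₀` vanishing at all but finitely many unit vectors. -/
def finitelySupported : Submodule ℝ (C₀(ℕ, ℝ) →L[ℝ] ℝ) where
  carrier := {u | ∀ᶠ n in atTop, u (unitVec n) = 0}
  add_mem' hu hv := by
    filter_upwards [hu, hv] with n h1 h2
    simp [h1, h2]
  zero_mem' := by simp
  smul_mem' c u hu := by
    filter_upwards [hu] with n h1
    simp [h1]

theorem infimalNorm_pos {E : Type*} [NormedAddCommGroup E] [NormedSpace ℝ E] (i : H →L[ℝ] E)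
    {x : E} (hx : x ≠ 0) : 0 < infimalNorm i x := by
  have h := norm_le_infimalNorm i x
  have := norm_pos_iff.2 hx
  by_contra! h0
  nlinarith [norm_nonneg i, mul_nonneg (add_nonneg zero_le_one (norm_nonneg i)) (neg_nonneg.2 h0)]

/-- The generating function `x ↦ ∑ₙ xₙ lⁿ` as a functional on `c₀`. -/
noncomputable def genFun (l : ℝ) : C₀(ℕ, ℝ) →L[ℝ] ℝ :=
  nuclearSum (fun n ↦ l ^ n) coord fun _ ↦ (1 : ℝ)

theorem hasSum_genFun {l : ℝ} (hl : 0 ≤ l) (hl' : l ≤ 1 / 2) (x : C₀(ℕ, ℝ)) :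
    HasSum (fun n ↦ l ^ n * x n) (genFun l x) := by
  have h := hasSum_nuclearSum (w := fun n ↦ l ^ n) (e := fun _ ↦ (1 : ℝ))
    (summable_geometric_of_lt_one hl (by linarith)) norm_coord_le (by simp) x
  simp only [coord_apply, smul_eq_mul, mul_one] at h
  exact h

theorem norm_genFun_le {l : ℝ} (hl : 0 ≤ l) (hl' : l ≤ 1 / 2) : ‖genFun l‖ ≤ 2 := by
  have h := norm_nuclearSum_le (w := fun n ↦ l ^ n) (e := fun _ ↦ (1 : ℝ))
    (summable_geometric_of_lt_one hl (by linarith)) norm_coord_le (by simp)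
  refine h.trans ?_
  simp_rw [abs_pow, abs_of_nonneg hl]
  rw [tsum_geometric_of_lt_one hl (by linarith), mul_one, inv_le_comm₀ (by linarith) two_pos]
  linarith

theorem genFun_unitVec {l : ℝ} (hl : 0 ≤ l) (hl' : l ≤ 1 / 2) (n : ℕ) :
    genFun l (unitVec n) = l ^ n := by
  refine (hasSum_genFun hl hl' _).unique ?_
  convert hasSum_single n fun m hm ↦ ?_ using 1
  · simp [unitVec_apply]
  · simp [unitVec_apply, hm]

/-- Near `0` the generating function of `x` is equivalent to its first nonzero term. -/
theorem exists_tendsto_genFun_div_pow {x : C₀(ℕ, ℝ)} (hx : x ≠ 0) {l : ℕ → ℝ} (hl : ∀ k, 0 < l k)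
    (hl' : ∀ k, l k ≤ 1 / 2) (hlim : Tendsto l atTop (𝓝 0)) :
    ∃ (n : ℕ) (c : ℝ), c ≠ 0 ∧ Tendsto (fun k ↦ genFun (l k) x / l k ^ n) atTop (𝓝 c) := by
  classical
  have hex : ∃ n, x n ≠ 0 := by
    by_contra! h
    exact hx (ZeroAtInftyContinuousMap.ext h)
  refine ⟨Nat.find hex, x (Nat.find hex), Nat.find_spec hex, ?_⟩
  set n := Nat.find hex
  have hmin : ∀ m < n, x m = 0 := fun m hm ↦ not_not.1 (Nat.find_min hex hm)
  have hbound : ∀ k, |genFun (l k) x / l k ^ n - x n| ≤ l k * (2 * ‖x‖) := fun k ↦ by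
    have hpos : 0 < l k ^ n := pow_pos (hl k) n
    have hs := hasSum_genFun (hl k).le (hl' k) x
    have hs' : HasSum (fun m ↦ l k ^ (m + (n + 1)) * x (m + (n + 1)))
        (genFun (l k) x - l k ^ n * x n) := by
      have h := (hasSum_nat_add_iff' (n + 1)).2 hs
      rw [Finset.sum_range_succ, Finset.sum_eq_zero fun m hm ↦ by
        rw [hmin m (Finset.mem_range.1 hm), mul_zero], zero_add] at h
      exact h
    have hle : |genFun (l k) x - l k ^ n * x n| ≤ 2 * (l k ^ (n + 1) * ‖x‖) := by
      refine (Real.norm_eq_abs _).symm.trans_le ?_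
      rw [← hs'.tsum_eq]
      refine tsum_of_norm_bounded (hasSum_geometric_two.mul_right _) fun m ↦ ?_
      rw [norm_mul, norm_pow, Real.norm_of_nonneg (hl k).le, pow_add, mul_assoc]
      have := hl k
      gcongr
      · exact hl' k
      · exact abs_apply_le_norm x _
    rw [div_sub' hpos.ne', abs_div, abs_of_pos hpos, div_le_iff₀ hpos]
    refine hle.trans_eq ?_
    ring
  rw [tendsto_iff_norm_sub_tendsto_zero]
  exact squeeze_zero (fun _ ↦ norm_nonneg _) hbound (by simpa using hlim.mul_const (2 * ‖x‖))

/-- Functionals with different geometric decay rates are independent modulo finitely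
supported ones. -/
theorem eq_zero_of_tsum_mul_pow_eventually_eq_zero {c : ℕ → ℝ} (hc : Summable c)
    (h : ∀ᶠ n in atTop, ∑' m, c m * ((1 / 2 : ℝ) ^ (m + 1)) ^ n = 0) (m : ℕ) : c m = 0 := by
  induction m using Nat.strong_induction_on with
  | _ m ih =>
    have hlim : Tendsto (fun n : ℕ ↦ ∑' j, c j * ((1 / 2 : ℝ) ^ (j + 1)) ^ n *
        (2 ^ (m + 1)) ^ n) atTop (𝓝 (∑' j, if j = m then c j else 0)) := by
      refine tendsto_tsum_of_dominated_convergence hc.abs (fun j ↦ ?_) (.of_forall fun n j ↦ ?_)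
      · split_ifs with hj
        · subst hj
          simp
        · rcases lt_or_gt_of_ne hj with hj | hj
          · simp [ih j hj]
          · simp_rw [mul_assoc, ← mul_pow]
            have : Tendsto (fun n : ℕ ↦ ((1 / 2 : ℝ) ^ (j + 1) * 2 ^ (m + 1)) ^ n) atTop (𝓝 0) := by
              refine tendsto_pow_atTop_nhds_zero_of_lt_one (by positivity) ?_
              rw [one_div, inv_pow, inv_mul_lt_iff₀ (by positivity), mul_one]
              gcongr
              norm_num
            simpa using this.const_mul (c j)
      · rcases lt_or_ge j m with hj | hj
        · simp [ih j hj]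
        · rw [mul_assoc, ← mul_pow, norm_mul, norm_pow, Real.norm_eq_abs]
          refine mul_le_of_le_one_right (abs_nonneg _) (pow_le_one₀ (norm_nonneg _) ?_)
          rw [Real.norm_of_nonneg (by positivity), one_div, inv_pow,
            inv_mul_le_iff₀ (by positivity), mul_one]
          gcongr
          norm_num
    rw [tsum_ite_eq] at hlim
    refine tendsto_nhds_unique hlim (tendsto_const_nhds.congr' ?_)
    filter_upwards [h] with n hn
    rw [tsum_mul_right, hn, zero_mul]

end NullSequences

section MomentOperators

open scoped ZeroAtInfty
open ZeroAtInftyContinuousMap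

/-- The decay rates, pairwise different powers of `1 / 2`. -/
noncomputable def rate (k j : ℕ) : ℝ := (1 / 2) ^ (Nat.pair k j + 1)

theorem rate_pos (k j : ℕ) : 0 < rate k j := by
  unfold rate
  positivity

theorem rate_le (k j : ℕ) : rate k j ≤ 1 / 2 :=
  pow_le_of_le_one (by norm_num) (by norm_num) (Nat.succ_ne_zero _)

theorem tendsto_rate_left (j : ℕ) : Tendsto (fun k ↦ rate k j) atTop (𝓝 0) :=
  squeeze_zero (fun k ↦ (rate_pos k j).le)
    (fun k ↦ pow_le_pow_of_le_one (by norm_num) (by norm_num)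
      ((Nat.left_le_pair k j).trans (Nat.le_succ _)))
    (tendsto_pow_atTop_nhds_zero_of_lt_one (r := (1 / 2 : ℝ)) (by norm_num) (by norm_num))

theorem tendsto_rate_right (k : ℕ) : Tendsto (fun j ↦ rate k j) atTop (𝓝 0) :=
  squeeze_zero (fun j ↦ (rate_pos k j).le)
    (fun j ↦ pow_le_pow_of_le_one (by norm_num) (by norm_num)
      ((Nat.right_le_pair k j).trans (Nat.le_succ _)))
    (tendsto_pow_atTop_nhds_zero_of_lt_one (r := (1 / 2 : ℝ)) (by norm_num) (by norm_num))

/-- The weights of the moment operators; for each `k` the weight with `j = 0` dominates. -/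
noncomputable def weight (k j : ℕ) : ℝ :=
  (1 / 2) ^ k * (1 / 2) ^ j * if j = 0 then 1 else rate k 0 ^ k

theorem weight_pos (k j : ℕ) : 0 < weight k j := by
  have := rate_pos k 0
  unfold weight
  split_ifs <;> positivity

theorem weight_le (k j : ℕ) : weight k j ≤ (1 / 2) ^ k * (1 / 2) ^ j := by
  refine mul_le_of_le_one_right (by positivity) ?_
  split_ifs
  · exact le_rfl
  · exact pow_le_one₀ (rate_pos k 0).le ((rate_le k 0).trans (by norm_num))

theorem summable_weight (k : ℕ) : Summable (weight k) :=
  (summable_geometric_two.mul_left _).of_nonneg_of_le (fun j ↦ (weight_pos k j).le) (weight_le k)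

variable {H : Type*} [NormedAddCommGroup H] [InnerProductSpace ℝ H]

/-- The operators `x ↦ ∑ⱼ wₖⱼ (∑ₙ xₙ λₖⱼⁿ) bⱼ`. -/
noncomputable def momentOp (b : HilbertBasis ℕ ℝ H) (k : ℕ) : C₀(ℕ, ℝ) →L[ℝ] H :=
  nuclearSum (weight k) (fun j ↦ genFun (rate k j)) b

variable (b : HilbertBasis ℕ ℝ H)

theorem norm_momentOp_le (k : ℕ) : ‖momentOp b k‖ ≤ (1 / 2) ^ k * 4 := by
  refine (norm_nuclearSum_le (summable_weight k)
    (fun j ↦ norm_genFun_le (rate_pos k j).le (rate_le k j))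
    fun j ↦ (b.orthonormal.1 j).le).trans ?_
  have h : ∑' j, |weight k j| ≤ (1 / 2) ^ k * 2 := by
    rw [← congrArg ((1 / 2 : ℝ) ^ k * ·) tsum_geometric_two, ← tsum_mul_left]
    refine (summable_weight k).abs.tsum_le_tsum (fun j ↦ ?_) (summable_geometric_two.mul_left _)
    rw [abs_of_pos (weight_pos k j)]
    exact weight_le k j
  linarith

theorem summable_norm_momentOp : Summable fun k ↦ ‖momentOp b k‖ :=
  (summable_geometric_two.mul_right 4).of_nonneg_of_le (fun k ↦ norm_nonneg (momentOp b k))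
    (norm_momentOp_le b)

theorem Supports.inv_smul {E : Type*} [NormedAddCommGroup E] [NormedSpace ℝ E] {i : H →L[ℝ] E}
    {u : E →L[ℝ] ℝ} {x : E} (hu : Supports (infimalNorm i) u x) :
    Supports (infimalNorm i) u ((infimalNorm i x)⁻¹ • x) :=
  hu.pos_smul (inv_nonneg.2 (apply_nonneg _ x))

theorem infimalNorm_inv_smul {E : Type*} [NormedAddCommGroup E] [NormedSpace ℝ E] (i : H →L[ℝ] E)
    {x : E} (hx : x ≠ 0) : infimalNorm i ((infimalNorm i x)⁻¹ • x) = 1 := by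
  rw [map_smul_eq_mul, norm_inv, Real.norm_of_nonneg (apply_nonneg _ x),
    inv_mul_cancel₀ (infimalNorm_pos i hx).ne']

variable [CompleteSpace H]

theorem hasSum_momentOp (k : ℕ) (x : C₀(ℕ, ℝ)) :
    HasSum (fun j ↦ (weight k j * genFun (rate k j) x) • b j) (momentOp b k x) :=
  hasSum_nuclearSum (summable_weight k)
    (fun j ↦ norm_genFun_le (rate_pos k j).le (rate_le k j)) (fun j ↦ (b.orthonormal.1 j).le) x

theorem hasSum_inner_momentOp (d : H) (k : ℕ) (x : C₀(ℕ, ℝ)) :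
    HasSum (fun j ↦ weight k j * genFun (rate k j) x * inner ℝ d (b j))
      (inner ℝ d (momentOp b k x)) := by
  simpa [inner_smul_right] using (hasSum_momentOp b k x).mapL (innerSL ℝ d)

theorem inner_basis_momentOp (k j : ℕ) (x : C₀(ℕ, ℝ)) :
    inner ℝ (b j) (momentOp b k x) = weight k j * genFun (rate k j) x := by
  refine (hasSum_inner_momentOp b (b j) k x).unique ?_
  convert hasSum_single j fun m hm ↦ ?_ using 1
  · simp [b.orthonormal.1 j]
  · simp [b.orthonormal.2 hm.symm]

theorem momentOp_injective (k : ℕ) : Function.Injective (momentOp b k) := by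
  rw [injective_iff_map_eq_zero]
  intro x hx
  by_contra hx0
  obtain ⟨n, c, hc, hlim⟩ := exists_tendsto_genFun_div_pow hx0 (rate_pos k) (rate_le k)
    (tendsto_rate_right k)
  refine hc (tendsto_nhds_unique hlim (tendsto_const_nhds.congr fun j ↦ ?_))
  have h := inner_basis_momentOp b k j x
  rw [hx, inner_zero_right, eq_comm, mul_eq_zero, or_iff_right (weight_pos k j).ne'] at h
  rw [h, zero_div]

theorem norm_momentOp_sub_le (k : ℕ) (x : C₀(ℕ, ℝ)) :
    ‖momentOp b k x - (weight k 0 * genFun (rate k 0) x) • b 0‖ ≤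
      2 * (weight k 0 * rate k 0 ^ k * ‖x‖) := by
  have h := (hasSum_nat_add_iff' 1).2 (hasSum_momentOp b k x)
  rw [Finset.sum_range_one] at h
  rw [← h.tsum_eq]
  refine tsum_of_norm_bounded (hasSum_geometric_two.mul_right _) fun j ↦ ?_
  rw [norm_smul, b.orthonormal.1, mul_one, norm_mul, Real.norm_of_nonneg (weight_pos k _).le]
  have hg : ‖genFun (rate k (j + 1)) x‖ ≤ 2 * ‖x‖ :=
    (genFun _).le_of_opNorm_le (norm_genFun_le (rate_pos k _).le (rate_le k _)) x
  refine (mul_le_mul_of_nonneg_left hg (weight_pos k _).le).trans_eq ?_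
  simp only [weight, Nat.add_eq_zero_iff, one_ne_zero, and_false, if_false, if_true]
  ring

/-- The normalized values of the moment operators all converge to the same direction. -/
theorem exists_tendsto_smul_momentOp {x : C₀(ℕ, ℝ)} (hx : x ≠ 0) :
    ∃ c : ℕ → ℝ, (∀ᶠ k in atTop, c k ≠ 0) ∧
      Tendsto (fun k ↦ c k • momentOp b k x) atTop (𝓝 (b 0)) := by
  obtain ⟨n, a, ha, hlim⟩ := exists_tendsto_genFun_div_pow hx (fun k ↦ rate_pos k 0)
    (fun k ↦ rate_le k 0) (tendsto_rate_left 0)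
  have hne : ∀ᶠ k in atTop, weight k 0 * genFun (rate k 0) x ≠ 0 := by
    filter_upwards [hlim.eventually_ne ha] with k hk
    refine mul_ne_zero (weight_pos k 0).ne' fun h0 ↦ hk ?_
    rw [h0, zero_div]
  refine ⟨fun k ↦ (weight k 0 * genFun (rate k 0) x)⁻¹, hne.mono fun k hk ↦ inv_ne_zero hk, ?_⟩
  have hpow : Tendsto (fun k ↦ rate k 0 ^ k / rate k 0 ^ n) atTop (𝓝 0) := by
    refine squeeze_zero' (.of_forall fun k ↦ ?_) ?_ (tendsto_rate_left 0)
    · have := rate_pos k 0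
      positivity
    · filter_upwards [eventually_gt_atTop n] with k hk
      rw [div_le_iff₀ (pow_pos (rate_pos k 0) n), ← pow_succ']
      exact pow_le_pow_of_le_one (rate_pos k 0).le ((rate_le k 0).trans (by norm_num)) hk
  have hquot : Tendsto (fun k ↦
      |rate k 0 ^ k / rate k 0 ^ n / (genFun (rate k 0) x / rate k 0 ^ n)| * (2 * ‖x‖)) atTop (𝓝 0) := by
    simpa using ((hpow.div hlim ha).abs.mul_const (2 * ‖x‖))
  rw [tendsto_iff_norm_sub_tendsto_zero]
  refine squeeze_zero' (.of_forall fun _ ↦ norm_nonneg _) ?_ hquot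
  filter_upwards [hne] with k hk
  have hr := rate_pos k 0
  have hw := weight_pos k 0
  have heq : (weight k 0 * genFun (rate k 0) x)⁻¹ • momentOp b k x - b 0 =
      (weight k 0 * genFun (rate k 0) x)⁻¹ •
        (momentOp b k x - (weight k 0 * genFun (rate k 0) x) • b 0) := by
    rw [smul_sub, inv_smul_smul₀ hk]
  rw [heq, norm_smul, norm_inv, norm_mul, Real.norm_of_nonneg hw.le, Real.norm_eq_abs,
    div_div_div_cancel_right₀ (pow_pos hr n).ne', abs_div, abs_of_pos (pow_pos hr k)]
  have hg : 0 < |genFun (rate k 0) x| := abs_pos.2 (right_ne_zero_of_mul hk)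
  refine (mul_le_mul_of_nonneg_left (norm_momentOp_sub_le b k x) (by positivity)).trans_eq ?_
  field_simp

theorem tendsto_abs_inner_direction_momentOp {x y : C₀(ℕ, ℝ)} (hx : x ≠ 0) (hy : y ≠ 0) :
    Tendsto (fun k ↦ |inner ℝ (direction (momentOp b k x)) (direction (momentOp b k y))|)
      atTop (𝓝 1) := by
  obtain ⟨c, hc, hcx⟩ := exists_tendsto_smul_momentOp b hx
  obtain ⟨d, hd, hdy⟩ := exists_tendsto_smul_momentOp b hy
  have hb : b 0 ≠ 0 := b.orthonormal.ne_zero 0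
  have h := (((continuousAt_direction hb).tendsto.comp hcx).inner (𝕜 := ℝ)
    ((continuousAt_direction hb).tendsto.comp hdy)).abs
  rw [real_inner_self_eq_norm_sq, norm_direction hb, one_pow, abs_one] at h
  refine h.congr' ?_
  filter_upwards [hc, hd] with k hck hdk
  have hsign : ∀ {s : ℝ}, s ≠ 0 → |(SignType.sign s : ℝ)| = 1 := fun {s} hs ↦ by
    rcases hs.lt_or_gt with hs | hs <;> simp [hs]
  simp only [Function.comp_apply, direction_smul, real_inner_smul_left, real_inner_smul_right,
    abs_mul, hsign hck, hsign hdk, one_mul]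

theorem eq_zero_of_hasSum_inner_momentOp {d : ℕ → H} {C : ℝ} {g : C₀(ℕ, ℝ) →L[ℝ] ℝ}
    (hd : ∀ k, ‖d k‖ ≤ C) (hg : g ∈ finitelySupported)
    (hsum : ∀ y, HasSum (fun k ↦ inner ℝ (d k) (momentOp b k y)) (g y)) (k : ℕ) : d k = 0 := by
  let a : ℕ × ℕ → ℝ := fun q ↦ weight q.1 q.2 * inner ℝ (d q.1) (b q.2)
  have hbound : ∀ q, ‖a q‖ ≤ (1 / 2) ^ q.1 * (1 / 2) ^ q.2 * C := fun q ↦ by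
    rw [norm_mul, Real.norm_of_nonneg (weight_pos _ _).le]
    have h1 : ‖inner ℝ (d q.1) (b q.2)‖ ≤ C := by
      refine (norm_inner_le_norm _ _).trans ?_
      rw [b.orthonormal.1, mul_one]
      exact hd _
    exact mul_le_mul (weight_le _ _) h1 (norm_nonneg _) (by positivity)
  have ha : Summable a := .of_norm_bounded
    ((summable_geometric_two.mul_of_nonneg summable_geometric_two
      (fun _ ↦ by positivity) fun _ ↦ by positivity).mul_right C) hbound
  have hval : ∀ n, ∑' m, a (Nat.unpair m) * ((1 / 2 : ℝ) ^ (m + 1)) ^ n = g (unitVec n) :=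
      fun n ↦ by
    have hs : Summable fun q : ℕ × ℕ ↦ a q * rate q.1 q.2 ^ n := by
      refine .of_norm_bounded ha.norm fun q ↦ ?_
      rw [norm_mul, norm_pow, Real.norm_of_nonneg (rate_pos _ _).le]
      exact mul_le_of_le_one_right (norm_nonneg _)
        (pow_le_one₀ (rate_pos _ _).le ((rate_le _ _).trans (by norm_num)))
    have hk : ∀ k, HasSum (fun j ↦ a (k, j) * rate k j ^ n)
        (inner ℝ (d k) (momentOp b k (unitVec n))) := fun k ↦ by
      convert hasSum_inner_momentOp b (d k) k (unitVec n) using 2 with j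
      rw [genFun_unitVec (rate_pos k j).le (rate_le k j)]
      ring
    rw [← (hs.hasSum.prod_fiberwise hk).unique (hsum (unitVec n)), ← Nat.pairEquiv.symm.tsum_eq]
    simp [rate]
  have hzero := eq_zero_of_tsum_mul_pow_eventually_eq_zero
    (Nat.pairEquiv.symm.summable_iff.2 ha) (hg.mono fun n hn ↦ (hval n).trans hn)
  refine b.repr.injective (lp.ext (funext fun j ↦ ?_))
  have h := hzero (Nat.pair k j)
  simp only [Function.comp_apply, Nat.pairEquiv_symm_apply, Nat.unpair_pair, a, mul_eq_zero,
    (weight_pos k j).ne', false_or] at h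
  rw [b.repr_apply_apply, real_inner_comm, h, map_zero, lp.coeFn_zero, Pi.zero_apply]

theorem admissible_momentOp :
    Admissible (infimalNorm (diagonalMap b)) (momentOp b) finitelySupported where
  summable := summable_norm_momentOp b
  injective := momentOp_injective b
  tendsto_inner _ _ := tendsto_abs_inner_direction_momentOp b
  mem_of_supports u x hu hx := by
    obtain ⟨ρ, -, -, -, -, hy, hmax⟩ := hu.inv_smul.exists_decomposition
      (denseRange_diagonalMap b) (infimalNorm_inv_smul _ hx)
    exact eventually_apply_unitVec_eq_zero hy hmax
  unique u v x hu hv hx := hu.inv_smul.unique (denseRange_diagonalMap b)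
    hv.inv_smul (infimalNorm_inv_smul _ hx)
  independent _ _ _ hd hg hsum := eq_zero_of_hasSum_inner_momentOp b hd hg hsum

end MomentOperators

section Renorming

universe u

variable {E : Type u} [NormedAddCommGroup E] [NormedSpace ℝ E]

/-- The space `E`, to be normed by `p`. -/
def Renormed (_ : Seminorm ℝ E) : Type u := E

instance (p : Seminorm ℝ E) : AddCommGroup (Renormed p) := inferInstanceAs (AddCommGroup E)

instance (p : Seminorm ℝ E) : Module ℝ (Renormed p) := inferInstanceAs (Module ℝ E)

theorem exists_renorming [CompleteSpace E] (p : Seminorm ℝ E) {c C : ℝ}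
    (hc : ∀ x, ‖x‖ ≤ c * p x) (hC : ∀ x, p x ≤ C * ‖x‖) :
    ∃ (X : Type u) (_ : NormedAddCommGroup X) (_ : NormedSpace ℝ X) (_ : CompleteSpace X)
      (J : X ≃L[ℝ] E), ∀ x, ‖x‖ = p (J x) := by
  let e : Renormed p ≃ₗ[ℝ] E := LinearEquiv.refl ℝ E
  let _ : Norm (Renormed p) := ⟨fun x ↦ p (e x)⟩
  have core : NormedSpace.Core ℝ (Renormed p) :=
    { norm_nonneg := fun x ↦ apply_nonneg p (e x)
      norm_smul := fun a x ↦ (congrArg p (map_smul e a x)).trans (map_smul_eq_mul p a (e x))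
      norm_triangle := fun x y ↦ (congrArg p (map_add e x y)).trans_le (map_add_le_add p _ _)
      norm_eq_zero_iff := fun x ↦ by
        refine ⟨fun h ↦ e.map_eq_zero_iff.1 (norm_le_zero_iff.1 ((hc (e x)).trans_eq ?_)), ?_⟩
        · rw [show p (e x) = 0 from h, mul_zero]
        · rintro rfl
          exact (congrArg p (map_zero e)).trans (map_zero p) }
  let _ : NormedAddCommGroup (Renormed p) := .ofCore core
  let _ : NormedSpace ℝ (Renormed p) := .ofCore core
  let J : Renormed p ≃L[ℝ] E := e.toContinuousLinearEquivOfBounds c C hc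
    (fun x ↦ (hC x).trans_eq (by simp))
  exact ⟨Renormed p, inferInstance, inferInstance,
    (completeSpace_congr (e := J.toEquiv) J.isUniformEmbedding).2 inferInstance, J, fun _ ↦ rfl⟩

end Renorming

section Final

variable {X : Type*} [NormedAddCommGroup X] [NormedSpace ℝ X]

/-- If a nontrivial combination of two norm-attaining functionals of norm one is again a multiple of
such a functional, then the two agree up to sign and their support points are proportional. -/
def NoCoplanarSupports (X : Type*) [NormedAddCommGroup X] [NormedSpace ℝ X] : Prop :=
  ∀ (f₁ f₂ f₃ : X →L[ℝ] ℝ) (x₁ x₂ x₃ : X) (a b c : ℝ),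
    Supports (normSeminorm ℝ X) f₁ x₁ → x₁ ≠ 0 → Supports (normSeminorm ℝ X) f₂ x₂ → x₂ ≠ 0 →
    Supports (normSeminorm ℝ X) f₃ x₃ → x₃ ≠ 0 → a ≠ 0 → b ≠ 0 → a • f₁ + b • f₂ = c • f₃ →
    (∃ s : ℝ, x₁ = s • x₂) ∧ (f₁ = f₂ ∨ f₁ = -f₂)

theorem Admissible.noCoplanarSupports {E H : Type*} [NormedAddCommGroup E] [NormedSpace ℝ E]
    [NormedAddCommGroup H] [InnerProductSpace ℝ H] {p : Seminorm ℝ E} {T : ℕ → E →L[ℝ] H}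
    {Z : Submodule ℝ (E →L[ℝ] ℝ)} (h : Admissible p T Z) (J : X ≃L[ℝ] E)
    (hJ : ∀ x, ‖x‖ = (p + sumNorm T h.summable) (J x)) : NoCoplanarSupports X := by
  have key : ∀ {f : X →L[ℝ] ℝ} {x : X}, Supports (normSeminorm ℝ X) f x →
      Supports (p + sumNorm T h.summable) (f.comp (J.symm : E →L[ℝ] X)) (J x) := fun hf ↦
    ⟨fun y ↦ by simpa [hJ] using hf.1 (J.symm y), by simpa [hJ] using hf.2⟩
  intro f₁ f₂ f₃ x₁ x₂ x₃ a b c h₁ hx₁ h₂ hx₂ h₃ hx₃ ha hb hf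
  have hJ0 : ∀ {x}, x ≠ 0 → J x ≠ 0 := fun hx ↦ by simpa using hx
  obtain ⟨s, hs⟩ := h.exists_eq_smul (key h₁) (hJ0 hx₁) (key h₂) (hJ0 hx₂) (key h₃) (hJ0 hx₃) ha hb
    (by ext y; simpa using congrArg (fun F ↦ F (J.symm y)) hf)
  have hs' : x₁ = s • x₂ := J.injective (by simpa using hs)
  have hs0 : s ≠ 0 := by
    rintro rfl
    exact hx₁ (by simpa using hs')
  refine ⟨⟨s, hs'⟩, ?_⟩
  refine (h.eq_or_eq_neg (hs ▸ key h₁) (key h₂) (hJ0 hx₂) hs0).imp (fun h ↦ ?_) (fun h ↦ ?_)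
  all_goals
    ext y
    simpa using congrArg (fun F ↦ F (J y)) h

theorem exists_supports_of_normAttaining {f : X →L[ℝ] ℝ} (hf : f ≠ 0)
    (h : ∃ x : X, ‖x‖ = 1 ∧ |f x| = ‖f‖) :
    ∃ (c : ℝ) (F : X →L[ℝ] ℝ) (x : X), c ≠ 0 ∧ f = c • F ∧ x ≠ 0 ∧
      Supports (normSeminorm ℝ X) F x := by
  obtain ⟨x, hx, hfx⟩ := h
  have hf0 : 0 < ‖f‖ := norm_pos_iff.2 hf
  have hfx0 : f x ≠ 0 := by
    rw [← abs_pos, hfx]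
    exact hf0
  refine ⟨f x, (f x)⁻¹ • f, x, hfx0, by simp [smul_smul, hfx0], by rintro rfl; simp at hx,
    fun y ↦ ?_, by simp [hfx0, hx]⟩
  simp only [coe_normSeminorm, smul_apply, smul_eq_mul]
  refine (le_abs_self _).trans ?_
  rw [abs_mul, abs_inv, hfx, inv_mul_le_iff₀ hf0]
  exact f.le_opNorm y

theorem NoCoplanarSupports.not_normAttaining (hX : NoCoplanarSupports X) {f g : X →L[ℝ] ℝ}
    (hf : ∃ x : X, ‖x‖ = 1 ∧ |f x| = ‖f‖) (hg : ∃ x : X, ‖x‖ = 1 ∧ |g x| = ‖g‖)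
    (hfg : LinearIndependent ℝ ![f, g]) {t : ℝ} (ht0 : 0 < t) (ht1 : t < 1) :
    ¬ ∃ x : X, ‖x‖ = 1 ∧ |(t • f + (1 - t) • g) x| = ‖t • f + (1 - t) • g‖ := by
  intro hh
  rw [LinearIndependent.pair_iff] at hfg
  have hf0 : f ≠ 0 := by rintro rfl; simpa using hfg 1 0
  have hg0 : g ≠ 0 := by rintro rfl; simpa using hfg 0 1
  have hh0 : t • f + (1 - t) • g ≠ 0 := fun h0 ↦ ht0.ne' (hfg _ _ h0).1
  obtain ⟨a, F, x, ha, rfl, hx, hF⟩ := exists_supports_of_normAttaining hf0 hf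
  obtain ⟨b, G, y, hb, rfl, hy, hG⟩ := exists_supports_of_normAttaining hg0 hg
  obtain ⟨c, K, z, hc, hK, hz, hKz⟩ := exists_supports_of_normAttaining hh0 hh
  rw [smul_smul, smul_smul] at hK
  have := (hX F G K x y z _ _ c hF hx hG hy hKz hz (mul_ne_zero ht0.ne' ha)
    (mul_ne_zero (sub_pos.2 ht1).ne' hb) hK).2
  rcases this with rfl | rfl
  · exact hb (hfg b (-a) (by rw [smul_smul, smul_smul, ← add_smul]; simp [mul_comm])).1
  · exact hb (hfg b a (by rw [smul_smul, smul_smul, smul_neg, mul_comm]; simp)).1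

theorem exists_supports_of_nearest (M : Submodule ℝ X) [IsClosed (M : Set X)] {x m : X}
    (hx : x ∉ M) (hm : m ∈ M) (hxm : ‖x - m‖ = Metric.infDist x (M : Set X)) :
    ∃ (x' : X) (f : X →L[ℝ] ℝ) (g : X ⧸ M →ₗ[ℝ] ℝ),
      (Submodule.Quotient.mk x' : X ⧸ M) = Submodule.Quotient.mk x ∧
      x' ≠ 0 ∧ Supports (normSeminorm ℝ X) f x' ∧ ∀ y, f y = g (Submodule.Quotient.mk y) := by
  have hq : (Submodule.Quotient.mk (x - m) : X ⧸ M) = Submodule.Quotient.mk x := by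
    rw [Submodule.Quotient.eq]
    simpa using hm
  have hq0 : (Submodule.Quotient.mk x : X ⧸ M) ≠ 0 := by
    rwa [Ne, Submodule.Quotient.mk_eq_zero]
  obtain ⟨g, hg, hgx⟩ := exists_dual_vector ℝ (Submodule.Quotient.mk x : X ⧸ M)
    (norm_ne_zero_iff.2 hq0)
  have hle : ∀ y, g (Submodule.Quotient.mk y) ≤ ‖y‖ := fun y ↦
    ((le_abs_self _).trans (g.le_opNorm _)).trans
      (by rw [hg, one_mul]; exact Submodule.Quotient.norm_mk_le M y)
  refine ⟨x - m, ((g : X ⧸ M →ₗ[ℝ] ℝ).comp M.mkQ).mkContinuous 1 fun y ↦ ?_, g, hq, ?_,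
    ⟨hle, ?_⟩, fun y ↦ rfl⟩
  · rw [one_mul, Real.norm_eq_abs, abs_le']
    exact ⟨hle y, by simpa using hle (-y)⟩
  · intro h0
    rw [h0] at hq
    exact hq0 hq.symm
  · change g (Submodule.Quotient.mk (x - m)) = ‖x - m‖
    rw [hq, hgx, hxm]
    exact QuotientAddGroup.norm_mk x

theorem NoCoplanarSupports.exists_two_lines (hX : NoCoplanarSupports X) (M : Submodule ℝ X)
    (hM : IsClosed (M : Set X)) (hdim : Module.finrank ℝ (X ⧸ M) = 2) :
    ∃ x₁ x₂ : X,
      {q : X ⧸ M | ∃ x : X, x ∉ M ∧ (∃ m ∈ M, ‖x - m‖ = Metric.infDist x (M : Set X)) ∧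
          q = Submodule.Quotient.mk x} ⊆
        {q : X ⧸ M | ∃ c : ℝ, q = c • (Submodule.Quotient.mk x₁ : X ⧸ M)} ∪
        {q : X ⧸ M | ∃ c : ℝ, q = c • (Submodule.Quotient.mk x₂ : X ⧸ M)} := by
  set G := {q : X ⧸ M | ∃ x : X, x ∉ M ∧ (∃ m ∈ M, ‖x - m‖ = Metric.infDist x (M : Set X)) ∧
    q = Submodule.Quotient.mk x} with hG
  have hne : ∀ q ∈ G, q ≠ 0 := by
    rintro _ ⟨x, hx, -, rfl⟩
    rwa [Ne, Submodule.Quotient.mk_eq_zero]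
  have hsupp : ∀ q ∈ G, ∃ (x : X) (f : X →L[ℝ] ℝ) (g : X ⧸ M →ₗ[ℝ] ℝ),
      Submodule.Quotient.mk x = q ∧ x ≠ 0 ∧ Supports (normSeminorm ℝ X) f x ∧
        ∀ y, f y = g (Submodule.Quotient.mk y) := by
    rintro _ ⟨x, hx, ⟨m, hm, hxm⟩, rfl⟩
    exact exists_supports_of_nearest M hx hm hxm
  have htriple : ∀ q₁ ∈ G, ∀ q₂ ∈ G, ∀ q₃ ∈ G,
      (∃ s : ℝ, q₁ = s • q₂) ∨ (∃ s : ℝ, q₁ = s • q₃) ∨ (∃ s : ℝ, q₂ = s • q₃) := by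
    intro q₁ hq₁ q₂ hq₂ q₃ hq₃
    obtain ⟨x₁, f₁, g₁, rfl, hx₁, h₁, hfg₁⟩ := hsupp q₁ hq₁
    obtain ⟨x₂, f₂, g₂, rfl, hx₂, h₂, hfg₂⟩ := hsupp q₂ hq₂
    obtain ⟨x₃, f₃, g₃, rfl, hx₃, h₃, hfg₃⟩ := hsupp q₃ hq₃
    have : FiniteDimensional ℝ (X ⧸ M) := .of_finrank_pos (by omega)
    have hdep : ¬ LinearIndependent ℝ ![g₁, g₂, g₃] := fun h ↦ by
      have := h.fintype_card_le_finrank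
      rw [show Module.finrank ℝ (X ⧸ M →ₗ[ℝ] ℝ) = _ from Subspace.dual_finrank_eq, hdim] at this
      simp at this
    obtain ⟨w, hw, hw0⟩ := Fintype.not_linearIndependent_iff.1 hdep
    simp only [Fin.sum_univ_three, Matrix.cons_val] at hw
    have hf : w 0 • f₁ + w 1 • f₂ + w 2 • f₃ = 0 := by
      ext y
      simpa [hfg₁, hfg₂, hfg₃] using congrArg (fun g ↦ g (Submodule.Quotient.mk y)) hw
    have hf0 : ∀ {f : X →L[ℝ] ℝ} {x : X}, x ≠ 0 → Supports (normSeminorm ℝ X) f x → f ≠ 0 := by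
      rintro _ x hx hs rfl
      exact hx (norm_eq_zero.1 (by simpa using hs.2.symm))
    have hmk : ∀ {x y : X}, (∃ s : ℝ, x = s • y) →
        ∃ s : ℝ, (Submodule.Quotient.mk x : X ⧸ M) = s • Submodule.Quotient.mk y := by
      rintro _ y ⟨s, rfl⟩
      exact ⟨s, rfl⟩
    by_cases h0 : w 0 = 0
    · by_cases h1 : w 1 = 0
      · have h2 : w 2 ≠ 0 := by
          intro h2
          obtain ⟨i, hi⟩ := hw0
          fin_cases i <;> contradiction
        simp [h0, h1, h2, hf0 hx₃ h₃] at hf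
      · have h2 : w 2 ≠ 0 := by
          intro h2
          simp [h0, h1, h2, hf0 hx₂ h₂] at hf
        exact .inr (.inr (hmk (hX f₂ f₃ f₁ x₂ x₃ x₁ _ _ 0 h₂ hx₂ h₃ hx₃ h₁ hx₁ h1 h2
          (by simpa [h0] using hf)).1))
    · by_cases h1 : w 1 = 0
      · have h2 : w 2 ≠ 0 := by
          intro h2
          simp [h0, h1, h2, hf0 hx₁ h₁] at hf
        exact .inr (.inl (hmk (hX f₁ f₃ f₂ x₁ x₃ x₂ _ _ 0 h₁ hx₁ h₃ hx₃ h₂ hx₂ h0 h2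
          (by simpa [h1] using hf)).1))
      · exact .inl (hmk (hX f₁ f₂ f₃ x₁ x₂ x₃ _ _ (-w 2) h₁ hx₁ h₂ hx₂ h₃ hx₃ h0 h1
          ((eq_neg_of_add_eq_zero_left hf).trans (by ext; simp))).1)
  have hsymm : ∀ q ∈ G, ∀ r : X ⧸ M, (∃ s : ℝ, q = s • r) → ∃ s : ℝ, r = s • q := by
    rintro q hq r ⟨s, rfl⟩
    have hs : s ≠ 0 := by
      rintro rfl
      exact hne _ hq (zero_smul _ _)
    exact ⟨s⁻¹, by rw [smul_smul, inv_mul_cancel₀ hs, one_smul]⟩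
  by_cases hpair : ∃ q₁ ∈ G, ∃ q₂ ∈ G, ¬ ∃ s : ℝ, q₁ = s • q₂
  · obtain ⟨q₁, hq₁, q₂, hq₂, h12⟩ := hpair
    obtain ⟨x₁, rfl⟩ := Submodule.Quotient.mk_surjective M q₁
    obtain ⟨x₂, rfl⟩ := Submodule.Quotient.mk_surjective M q₂
    refine ⟨x₁, x₂, fun q hq ↦ ?_⟩
    rcases htriple _ hq₁ _ hq₂ q hq with h | h | h
    · exact absurd h h12
    · exact .inl (hsymm _ hq₁ _ h)
    · exact .inr (hsymm _ hq₂ _ h)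
  · push Not at hpair
    rcases G.eq_empty_or_nonempty with h | ⟨q₀, hq₀⟩
    · exact ⟨0, 0, by simp [h]⟩
    · obtain ⟨x₀, rfl⟩ := Submodule.Quotient.mk_surjective M q₀
      exact ⟨x₀, x₀, fun q hq ↦ .inl (hpair q hq _ hq₀)⟩

end Final

theorem exists_noCoplanarSupports {H : Type*} [NormedAddCommGroup H]
    [InnerProductSpace ℝ H] [CompleteSpace H] (b : HilbertBasis ℕ ℝ H) :
    ∃ (X : Type) (_ : NormedAddCommGroup X) (_ : NormedSpace ℝ X) (_ : CompleteSpace X),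
      ¬ FiniteDimensional ℝ X ∧ NoCoplanarSupports X := by
  have hadm := admissible_momentOp b
  let p : Seminorm ℝ (ZeroAtInftyContinuousMap ℕ ℝ) :=
    infimalNorm (diagonalMap b) + sumNorm (momentOp b) hadm.summable
  have hi : ∀ x, ‖x‖ ≤ (1 + ‖diagonalMap b‖) * p x := fun x ↦
    (norm_le_infimalNorm (diagonalMap b) x).trans <| by
      have : infimalNorm (diagonalMap b) x ≤ p x := le_add_of_nonneg_right (apply_nonneg _ x)
      gcongr
  have hp : ∀ x, p x ≤ (1 + ∑' k, ‖momentOp b k‖) * ‖x‖ := fun x ↦ by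
    rw [add_mul, one_mul]
    exact add_le_add (infimalNorm_le_norm _ x) (sumNorm_le _ hadm.summable x)
  obtain ⟨X, h₁, h₂, h₃, J, hJ⟩ := exists_renorming p hi hp
  exact ⟨X, h₁, h₂, h₃, fun _ ↦ ZeroAtInftyContinuousMap.not_finiteDimensional
    J.toLinearEquiv.finiteDimensional, hadm.noCoplanarSupports J hJ⟩

/-- There is an infinite-dimensional real Banach space `X` such that (i) the norm-attaining
segment property holds, and (ii) for every closed subspace `M` of codimension two there
are `x₁, x₂ ∈ X` such that the set of classes `π_M(x)` of points `x ∉ M` admitting a nearest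
point in `M` is contained in `ℝ·π_M(x₁) ∪ ℝ·π_M(x₂)`. -/
theorem statement9 :
    ∃ (X : Type) (_ : NormedAddCommGroup X) (_ : NormedSpace ℝ X) (_ : CompleteSpace X),
      ¬ FiniteDimensional ℝ X ∧
      (∀ f g : X →L[ℝ] ℝ,
        (∃ x : X, ‖x‖ = 1 ∧ |f x| = ‖f‖) →
        (∃ x : X, ‖x‖ = 1 ∧ |g x| = ‖g‖) →
        LinearIndependent ℝ ![f, g] →
        ∀ t : ℝ, 0 < t → t < 1 →
          ¬ ∃ x : X, ‖x‖ = 1 ∧ |(t • f + (1 - t) • g) x| = ‖t • f + (1 - t) • g‖) ∧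
      (∀ M : Submodule ℝ X, IsClosed (M : Set X) → Module.finrank ℝ (X ⧸ M) = 2 →
        ∃ x₁ x₂ : X,
          {q : X ⧸ M | ∃ x : X, x ∉ M ∧ (∃ m ∈ M, ‖x - m‖ = Metric.infDist x (M : Set X)) ∧
              q = Submodule.Quotient.mk x} ⊆
            {q : X ⧸ M | ∃ c : ℝ, q = c • (Submodule.Quotient.mk x₁ : X ⧸ M)} ∪
            {q : X ⧸ M | ∃ c : ℝ, q = c • (Submodule.Quotient.mk x₂ : X ⧸ M)}) := by
  obtain ⟨X, h₁, h₂, h₃, hinf, hX⟩ := exists_noCoplanarSupports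
    (default : HilbertBasis ℕ ℝ (lp (fun _ : ℕ ↦ ℝ) 2))
  exact ⟨X, h₁, h₂, h₃, hinf,
    fun f g hf hg hfg t ht0 ht1 ↦ hX.not_normAttaining hf hg hfg ht0 ht1,
    fun M hM hdim ↦ hX.exists_two_lines M hM hdim⟩
end

section
/- Let Φ : ℕ → ℝ satisfy Φ(n) > 0 for all n, Φ summable, and ∑_n Φ(n) < 1. Then: (i) for every a ∈ ℓ₂ the sequence (Φ(n)·a(n))_n belongs to ℓ₁, and the diagonal operator S_Φ : ℓ₂ → ℓ₁, (S_Φ a)(n) = Φ(n)·a(n), is a bounded linear operator with ‖S_Φ‖ ≤ ∑_n Φ(n); and (ii) there exists a norm ν on ℓ₁ whose closed unit ball {x ∈ ℓ₁ : ν(x) ≤ 1} equals the set {y + S_Φ(a) : y ∈ ℓ₁, ‖y‖₁ ≤ 1, a ∈ ℓ₂, ‖a‖₂ ≤ 1}, and this norm satisfies ν(x) ≤ ‖x‖₁ ≤ (1 + ∑_n Φ(n))·ν(x) for all x ∈ ℓ₁. -/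
open scoped ENNReal

section

variable {Φ : ℕ → ℝ}

lemma sum_norm_mul_rpow_one_le (hΦ : ∀ n, 0 ≤ Φ n) (hs : Summable Φ)
    (a : lp (fun _ : ℕ => ℝ) 2) (s : Finset ℕ) :
    ∑ n ∈ s, ‖Φ n * a n‖ ^ (1 : ℝ≥0∞).toReal ≤ (∑' n, Φ n) * ‖a‖ := by
  calc ∑ n ∈ s, ‖Φ n * a n‖ ^ (1 : ℝ≥0∞).toReal ≤ ∑ n ∈ s, Φ n * ‖a‖ := by
        refine Finset.sum_le_sum fun n _ => ?_
        rw [ENNReal.toReal_one, Real.rpow_one, norm_mul, Real.norm_of_nonneg (hΦ n)]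
        exact mul_le_mul_of_nonneg_left (lp.norm_apply_le_norm two_ne_zero a n) (hΦ n)
    _ = (∑ n ∈ s, Φ n) * ‖a‖ := (Finset.sum_mul ..).symm
    _ ≤ (∑' n, Φ n) * ‖a‖ :=
        mul_le_mul_of_nonneg_right (hs.sum_le_tsum s fun n _ => hΦ n) (norm_nonneg a)

lemma memℓp_one_mul (hΦ : ∀ n, 0 ≤ Φ n) (hs : Summable Φ) (a : lp (fun _ : ℕ => ℝ) 2) :
    Memℓp (fun n => Φ n * a n) 1 :=
  memℓp_gen' (sum_norm_mul_rpow_one_le hΦ hs a)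

/-- The diagonal operator `a ↦ (Φ n * a n)ₙ` from `ℓ₂` to `ℓ₁`. -/
noncomputable def diagonalOperator (hΦ : ∀ n, 0 ≤ Φ n) (hs : Summable Φ) :
    lp (fun _ : ℕ => ℝ) 2 →L[ℝ] lp (fun _ : ℕ => ℝ) 1 :=
  LinearMap.mkContinuous
    { toFun := fun a => ⟨fun n => Φ n * a n, memℓp_one_mul hΦ hs a⟩
      map_add' := fun a b => by
        ext n
        exact mul_add (Φ n) (a n) (b n)
      map_smul' := fun c a => by
        ext n
        exact mul_left_comm (Φ n) c (a n) }
    (∑' n, Φ n)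
    fun a => lp.norm_le_of_forall_sum_le (by simp)
      (mul_nonneg (tsum_nonneg hΦ) (norm_nonneg a)) fun s =>
        (sum_norm_mul_rpow_one_le hΦ hs a s).trans_eq (by simp)

lemma diagonalOperator_apply (hΦ : ∀ n, 0 ≤ Φ n) (hs : Summable Φ)
    (a : lp (fun _ : ℕ => ℝ) 2) (n : ℕ) : diagonalOperator hΦ hs a n = Φ n * a n := rfl

lemma norm_diagonalOperator_le (hΦ : ∀ n, 0 ≤ Φ n) (hs : Summable Φ) :
    ‖diagonalOperator hΦ hs‖ ≤ ∑' n, Φ n :=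
  LinearMap.mkContinuous_norm_le _ (tsum_nonneg hΦ) _

lemma isClosed_setOf_forall_sum_rpow_le {p : ℝ} (hp : 0 ≤ p) {f : (ℕ → ℝ) → ℕ → ℝ}
    (hf : Continuous f) (r : ℝ) :
    IsClosed {a : ℕ → ℝ | ∀ s : Finset ℕ, ∑ n ∈ s, ‖f a n‖ ^ p ≤ r ^ p} := by
  rw [Set.ofPred_forall]
  refine isClosed_iInter fun s => isClosed_le ?_ continuous_const
  exact continuous_finsetSum _ fun n _ =>
    (((continuous_apply n).comp hf).norm).rpow_const fun _ => Or.inr hp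

lemma exists_norm_le_of_forall_gt (hΦ : ∀ n, 0 ≤ Φ n) (hs : Summable Φ)
    (x : lp (fun _ : ℕ => ℝ) 1) {m : ℝ} (hm : 0 ≤ m)
    (h : ∀ r, m < r → ∃ a, ‖a‖ ≤ r ∧ ‖x - diagonalOperator hΦ hs a‖ ≤ r) :
    ∃ a, ‖a‖ ≤ m ∧ ‖x - diagonalOperator hΦ hs a‖ ≤ m := by
  let A (r : ℝ) : Set (ℕ → ℝ) := {a | ∀ s : Finset ℕ,
    ∑ n ∈ s, ‖a n‖ ^ (2 : ℝ≥0∞).toReal ≤ r ^ (2 : ℝ≥0∞).toReal}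
  let B (r : ℝ) : Set (ℕ → ℝ) := {a | ∀ s : Finset ℕ,
    ∑ n ∈ s, ‖x n - Φ n * a n‖ ^ (1 : ℝ≥0∞).toReal ≤ r ^ (1 : ℝ≥0∞).toReal}
  have closed (r : ℝ) : IsClosed (A r ∩ B r) :=
    (isClosed_setOf_forall_sum_rpow_le (f := id) (by simp) continuous_id r).inter
      (isClosed_setOf_forall_sum_rpow_le (f := fun a n => x n - Φ n * a n) (by simp)
        (by fun_prop) r)
  have compact {r : ℝ} (hr : 0 ≤ r) : IsCompact (A r ∩ B r) := by
    refine (isCompact_univ_pi fun _ : ℕ => isCompact_Icc (a := -r) (b := r)).of_isClosed_subset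
      (closed r) fun a ha n _ => ?_
    have h1 := ha.1 {n}
    rw [Finset.sum_singleton, Real.rpow_le_rpow_iff (norm_nonneg _) hr (by simp)] at h1
    exact abs_le.mp h1
  have mono {r t : ℝ} (hr : 0 ≤ r) (hrt : r ≤ t) : A r ∩ B r ⊆ A t ∩ B t := fun a ha =>
    ⟨fun s => (ha.1 s).trans (Real.rpow_le_rpow hr hrt (by simp)),
      fun s => (ha.2 s).trans (Real.rpow_le_rpow hr hrt (by simp))⟩
  have pos (k : ℕ) : 0 < 1 / ((k : ℝ) + 1) := by positivity
  have nonempty (k : ℕ) : (A (m + 1 / (k + 1)) ∩ B (m + 1 / (k + 1))).Nonempty := by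
    obtain ⟨a, ha, hxa⟩ := h (m + 1 / (k + 1)) (by linarith [pos k])
    refine ⟨a, fun s => ?_, fun s => ?_⟩
    · exact (lp.sum_rpow_le_norm_rpow (by simp) a s).trans
        (Real.rpow_le_rpow (norm_nonneg _) ha (by simp))
    · exact (lp.sum_rpow_le_norm_rpow (by simp) (x - diagonalOperator hΦ hs a) s).trans
        (Real.rpow_le_rpow (norm_nonneg _) hxa (by simp))
  obtain ⟨a, ha⟩ := IsCompact.nonempty_iInter_of_sequence_nonempty_isCompact_isClosed
    (fun k : ℕ => A (m + 1 / (k + 1)) ∩ B (m + 1 / (k + 1)))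
    (fun k => mono (by linarith [pos (k + 1)])
      (by gcongr; simp))
    nonempty (compact (by linarith [pos 0])) (fun k => closed _)
  rw [Set.mem_iInter] at ha
  let b : lp (fun _ : ℕ => ℝ) 2 := ⟨a, memℓp_gen' (ha 0).1⟩
  have le_of_forall {c : ℝ} (hc : ∀ k : ℕ, c ≤ m + 1 / (k + 1)) : c ≤ m :=
    ge_of_tendsto' (by simpa using tendsto_one_div_add_atTop_nhds_zero_nat.const_add m) hc
  refine ⟨b, le_of_forall fun k => ?_, le_of_forall fun k => ?_⟩
  · exact lp.norm_le_of_forall_sum_le (by simp) (by linarith [pos k]) (ha k).1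
  · exact lp.norm_le_of_forall_sum_le (by simp) (by linarith [pos k]) (ha k).2

end

section

variable {E F : Type*} [NormedAddCommGroup E] [NormedSpace ℝ E]
  [NormedAddCommGroup F] [NormedSpace ℝ F]

/-- The gauge of the sum of the unit ball of `F` and the image under `T` of the unit ball of `E`. -/
noncomputable def ballSumGauge (T : E →L[ℝ] F) (x : F) : ℝ :=
  sInf {r | ∃ a, ‖a‖ ≤ r ∧ ‖x - T a‖ ≤ r}

variable (T : E →L[ℝ] F)

lemma ballSumGauge_nonneg (x : F) : 0 ≤ ballSumGauge T x :=
  Real.sInf_nonneg fun _ ⟨a, ha, _⟩ => (norm_nonneg a).trans ha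

variable {T} in
lemma ballSumGauge_le {x : F} {r : ℝ} {a : E} (ha : ‖a‖ ≤ r) (hx : ‖x - T a‖ ≤ r) :
    ballSumGauge T x ≤ r :=
  csInf_le ⟨0, fun _ ⟨b, hb, _⟩ => (norm_nonneg b).trans hb⟩ ⟨a, ha, hx⟩

lemma ballSumGauge_le_norm (x : F) : ballSumGauge T x ≤ ‖x‖ :=
  ballSumGauge_le (a := 0) (by simp) (by simp)

lemma exists_norm_le_of_ballSumGauge_lt {x : F} {r : ℝ} (h : ballSumGauge T x < r) :
    ∃ a, ‖a‖ ≤ r ∧ ‖x - T a‖ ≤ r := by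
  obtain ⟨t, ⟨a, ha, hx⟩, ht⟩ := exists_lt_of_csInf_lt (s := {r | ∃ a, ‖a‖ ≤ r ∧ ‖x - T a‖ ≤ r})
    ⟨‖x‖, 0, by simp, by simp⟩ h
  exact ⟨a, ha.trans ht.le, hx.trans ht.le⟩

lemma ballSumGauge_add_le (x y : F) :
    ballSumGauge T (x + y) ≤ ballSumGauge T x + ballSumGauge T y := by
  refine le_of_forall_pos_le_add fun ε hε => ?_
  obtain ⟨a, ha, hx⟩ := exists_norm_le_of_ballSumGauge_lt T
    (lt_add_of_pos_right (ballSumGauge T x) (half_pos hε))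
  obtain ⟨b, hb, hy⟩ := exists_norm_le_of_ballSumGauge_lt T
    (lt_add_of_pos_right (ballSumGauge T y) (half_pos hε))
  refine ballSumGauge_le (a := a + b) ?_ ?_
  · linarith [norm_add_le a b]
  · rw [map_add, add_sub_add_comm]
    linarith [norm_add_le (x - T a) (y - T b)]

lemma ballSumGauge_smul_le (c : ℝ) (x : F) :
    ballSumGauge T (c • x) ≤ |c| * ballSumGauge T x := by
  have scaled {r : ℝ} (hr : ballSumGauge T x < r) : ballSumGauge T (c • x) ≤ |c| * r := by
    obtain ⟨a, ha, hx⟩ := exists_norm_le_of_ballSumGauge_lt T hr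
    refine ballSumGauge_le (a := c • a) ?_ ?_
    · rw [norm_smul, Real.norm_eq_abs]
      gcongr
    · rw [map_smul, ← smul_sub, norm_smul, Real.norm_eq_abs]
      gcongr
  refine ge_of_tendsto (x := nhdsWithin (ballSumGauge T x) (Set.Ioi (ballSumGauge T x)))
    (((continuous_const_mul |c|).tendsto _).mono_left nhdsWithin_le_nhds) ?_
  filter_upwards [self_mem_nhdsWithin] with r hr using scaled hr

lemma ballSumGauge_smul (c : ℝ) (x : F) :
    ballSumGauge T (c • x) = |c| * ballSumGauge T x := by
  refine (ballSumGauge_smul_le T c x).antisymm ?_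
  rcases eq_or_ne c 0 with rfl | hc
  · simpa using ballSumGauge_nonneg T 0
  · have h := ballSumGauge_smul_le T c⁻¹ (c • x)
    rwa [inv_smul_smul₀ hc, abs_inv, ← div_eq_inv_mul, le_div_iff₀' (abs_pos.mpr hc)] at h

lemma norm_le_mul_ballSumGauge (x : F) : ‖x‖ ≤ (1 + ‖T‖) * ballSumGauge T x := by
  refine ge_of_tendsto (x := nhdsWithin (ballSumGauge T x) (Set.Ioi (ballSumGauge T x)))
    (((continuous_const_mul (1 + ‖T‖)).tendsto _).mono_left nhdsWithin_le_nhds) ?_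
  filter_upwards [self_mem_nhdsWithin] with r hr
  obtain ⟨a, ha, hx⟩ := exists_norm_le_of_ballSumGauge_lt T hr
  have hT := (T.le_opNorm a).trans (mul_le_mul_of_nonneg_left ha (norm_nonneg T))
  have h := norm_add_le (x - T a) (T a)
  rw [sub_add_cancel] at h
  linarith

end

/-- For `Φ : ℕ → ℝ` positive, summable, with `∑ Φ < 1`: (i) the diagonal map sends `ℓ₂`
into `ℓ₁` and defines a bounded operator `S_Φ : ℓ₂ → ℓ₁` with `‖S_Φ‖ ≤ ∑ Φ`; (ii) there is
a norm `ν` on `ℓ₁` whose closed unit ball is `B_{ℓ₁} + S_Φ(B_{ℓ₂})`, and it satisfies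
`ν(x) ≤ ‖x‖₁ ≤ (1 + ∑ Φ)·ν(x)`. -/
theorem statement11 (Φ : ℕ → ℝ) (hΦpos : ∀ n, 0 < Φ n) (hΦsum : Summable Φ)
    (hΦlt : ∑' n, Φ n < 1) :
    -- (i)
    (∀ a : lp (fun _ : ℕ => ℝ) 2, Memℓp (fun n => Φ n * a n) 1) ∧
    (∃ SΦ : lp (fun _ : ℕ => ℝ) 2 →L[ℝ] lp (fun _ : ℕ => ℝ) 1,
      (∀ (a : lp (fun _ : ℕ => ℝ) 2) (n : ℕ), SΦ a n = Φ n * a n) ∧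
      ‖SΦ‖ ≤ ∑' n, Φ n) ∧
    -- (ii)
    (∃ ν : lp (fun _ : ℕ => ℝ) 1 → ℝ,
      (∀ x y : lp (fun _ : ℕ => ℝ) 1, ν (x + y) ≤ ν x + ν y) ∧
      (∀ (c : ℝ) (x : lp (fun _ : ℕ => ℝ) 1), ν (c • x) = |c| * ν x) ∧
      (∀ x : lp (fun _ : ℕ => ℝ) 1, ν x = 0 → x = 0) ∧
      ({x : lp (fun _ : ℕ => ℝ) 1 | ν x ≤ 1} =
        {x : lp (fun _ : ℕ => ℝ) 1 |
          ∃ (y : lp (fun _ : ℕ => ℝ) 1) (a : lp (fun _ : ℕ => ℝ) 2),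
            ‖y‖ ≤ 1 ∧ ‖a‖ ≤ 1 ∧ ∀ n : ℕ, x n = y n + Φ n * a n}) ∧
      (∀ x : lp (fun _ : ℕ => ℝ) 1, ν x ≤ ‖x‖ ∧ ‖x‖ ≤ (1 + ∑' n, Φ n) * ν x)) := by
  have hΦ n := (hΦpos n).le
  let T := diagonalOperator hΦ hΦsum
  have lower (x : lp (fun _ : ℕ => ℝ) 1) : ‖x‖ ≤ (1 + ∑' n, Φ n) * ballSumGauge T x :=
    (norm_le_mul_ballSumGauge T x).trans <| mul_le_mul_of_nonneg_right
      (add_le_add_right (norm_diagonalOperator_le hΦ hΦsum) 1) (ballSumGauge_nonneg T x)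
  refine ⟨memℓp_one_mul hΦ hΦsum,
    ⟨T, diagonalOperator_apply hΦ hΦsum, norm_diagonalOperator_le hΦ hΦsum⟩,
    ballSumGauge T, ballSumGauge_add_le T, ballSumGauge_smul T, fun x hx => ?_, ?_,
    fun x => ⟨ballSumGauge_le_norm T x, lower x⟩⟩
  · simpa [hx] using lower x
  · ext x
    constructor
    · intro hx
      obtain ⟨a, ha, hxa⟩ := exists_norm_le_of_forall_gt hΦ hΦsum x zero_le_one
        fun r hr => exists_norm_le_of_ballSumGauge_lt T (lt_of_le_of_lt hx hr)
      exact ⟨x - T a, a, hxa, ha, fun n => (sub_add_cancel (x n) (Φ n * a n)).symm⟩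
    · rintro ⟨y, a, hy, ha, hxya⟩
      have hx : x = y + T a := by
        ext n
        exact hxya n
      refine ballSumGauge_le ha ?_
      rwa [hx, add_sub_cancel_right]
end

section
/- Let Φ : ℕ → ℝ satisfy Φ(n) > 0 for all n, Φ summable, and ∑_n Φ(n) < 1, and let S_Φ : ℓ₂ → ℓ₁ be the diagonal operator (S_Φ a)(n) = Φ(n)·a(n). Let ν be a norm on ℓ₁ whose closed unit ball equals {y + S_Φ(a) : ‖y‖₁ ≤ 1, ‖a‖₂ ≤ 1}. Then for every bounded real sequence f ∈ ℓ∞, the dual norm of f with respect to ν satisfies sup{ ∑_n f(n)·x(n) : x ∈ ℓ₁, ν(x) ≤ 1 } = ‖f‖_∞ + (∑_n (Φ(n)·f(n))²)^{1/2}. -/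
open scoped ENNReal

/-- The product of a summable real sequence with a bounded one is absolutely summable. -/
theorem memℓp_one_mul_of_bounded {Φ h : ℕ → ℝ} {C : ℝ} (hΦ : Summable fun n => |Φ n|)
    (hC : ∀ n, |h n| ≤ C) : Memℓp (fun n => Φ n * h n) 1 := by
  refine memℓp_gen ?_
  simp only [ENNReal.toReal_one, Real.rpow_one, Real.norm_eq_abs, abs_mul]
  exact Summable.of_nonneg_of_le (fun n => by positivity)
    (fun n => mul_le_mul_of_nonneg_left (hC n) (abs_nonneg _)) (hΦ.mul_right C)

theorem lp_one_hasSum_abs (y : lp (fun _ : ℕ => ℝ) 1) : HasSum (fun n => |y n|) ‖y‖ := by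
  simpa using lp.hasSum_norm (p := 1) (by simp) y

theorem lp_abs_apply_le_norm {p : ℝ≥0∞} (hp : p ≠ 0) (f : lp (fun _ : ℕ => ℝ) p) (n : ℕ) :
    |f n| ≤ ‖f‖ := by
  simpa using lp.norm_apply_le_norm hp f n

theorem lp_summable_mul (f : lp (fun _ : ℕ => ℝ) ∞) (y : lp (fun _ : ℕ => ℝ) 1) :
    Summable fun n => f n * y n := by
  refine Summable.of_norm_bounded ((lp_one_hasSum_abs y).summable.mul_left ‖f‖) fun n => ?_
  rw [Real.norm_eq_abs, abs_mul]
  exact mul_le_mul_of_nonneg_right (lp_abs_apply_le_norm (by simp) f n) (abs_nonneg _)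

theorem lp_tsum_mul_le (f : lp (fun _ : ℕ => ℝ) ∞) (y : lp (fun _ : ℕ => ℝ) 1) :
    ∑' n, f n * y n ≤ ‖f‖ * ‖y‖ := by
  rw [← (lp_one_hasSum_abs y).tsum_eq, ← tsum_mul_left]
  refine (lp_summable_mul f y).tsum_le_tsum (fun n => ?_)
    ((lp_one_hasSum_abs y).summable.mul_left ‖f‖)
  refine (le_abs_self _).trans ?_
  rw [abs_mul]
  exact mul_le_mul_of_nonneg_right (lp_abs_apply_le_norm (by simp) f n) (abs_nonneg _)

theorem lp_two_hasSum_inner (g a : lp (fun _ : ℕ => ℝ) 2) :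
    HasSum (fun n => g n * a n) (inner ℝ g a) := by
  simpa [mul_comm] using lp.hasSum_inner (𝕜 := ℝ) g a

/-- If `ν` is a norm on `ℓ₁` whose closed unit ball is `B_{ℓ₁} + S_Φ(B_{ℓ₂})` for a positive
summable `Φ` with `∑ Φ < 1`, then the dual norm of any `f ∈ ℓ∞` with respect to `ν` equals
`‖f‖_∞ + (∑ (Φ(n) f(n))²)^{1/2}`. -/
theorem statement12 (Φ : ℕ → ℝ) (hΦpos : ∀ n, 0 < Φ n) (hΦsum : Summable Φ)
    (hΦlt : ∑' n, Φ n < 1)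
    (ν : lp (fun _ : ℕ => ℝ) 1 → ℝ)
    (hν_add : ∀ x y : lp (fun _ : ℕ => ℝ) 1, ν (x + y) ≤ ν x + ν y)
    (hν_smul : ∀ (c : ℝ) (x : lp (fun _ : ℕ => ℝ) 1), ν (c • x) = |c| * ν x)
    (hν_def : ∀ x : lp (fun _ : ℕ => ℝ) 1, ν x = 0 → x = 0)
    (hν_ball : {x : lp (fun _ : ℕ => ℝ) 1 | ν x ≤ 1} =
      {x : lp (fun _ : ℕ => ℝ) 1 |
        ∃ (y : lp (fun _ : ℕ => ℝ) 1) (a : lp (fun _ : ℕ => ℝ) 2),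
          ‖y‖ ≤ 1 ∧ ‖a‖ ≤ 1 ∧ ∀ n : ℕ, x n = y n + Φ n * a n}) :
    ∀ f : lp (fun _ : ℕ => ℝ) ∞,
      sSup {s : ℝ | ∃ x : lp (fun _ : ℕ => ℝ) 1, ν x ≤ 1 ∧ s = ∑' n, f n * x n} =
        ‖f‖ + Real.sqrt (∑' n, (Φ n * f n) ^ 2) := by
  intro f
  have hΦabs : Summable fun n => |Φ n| := hΦsum.abs
  set g : lp (fun _ : ℕ => ℝ) 2 := ⟨fun n => Φ n * f n,
    (memℓp_one_mul_of_bounded hΦabs (lp_abs_apply_le_norm (by simp) f)).of_exponent_ge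
      (by norm_num)⟩
  have hgn : ∀ n, g n = Φ n * f n := fun n => rfl
  have hR : Real.sqrt (∑' n, (Φ n * f n) ^ 2) = ‖g‖ := by
    have h := (lp_two_hasSum_inner g g).tsum_eq
    rw [real_inner_self_eq_norm_sq] at h
    rw [← Real.sqrt_sq (norm_nonneg g), ← h]
    simp only [hgn, sq]
  have hpair : ∀ (x y : lp (fun _ : ℕ => ℝ) 1) (a : lp (fun _ : ℕ => ℝ) 2),
      (∀ n : ℕ, x n = y n + Φ n * a n) →
        ∑' n, f n * x n = ∑' n, f n * y n + inner ℝ g a := by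
    intro x y a h
    rw [← ((lp_summable_mul f y).hasSum.add (lp_two_hasSum_inner g a)).tsum_eq]
    refine tsum_congr fun n => ?_
    rw [h n, hgn]
    ring
  have hball : ∀ x : lp (fun _ : ℕ => ℝ) 1, ν x ≤ 1 ↔
      ∃ (y : lp (fun _ : ℕ => ℝ) 1) (a : lp (fun _ : ℕ => ℝ) 2),
        ‖y‖ ≤ 1 ∧ ‖a‖ ≤ 1 ∧ ∀ n : ℕ, x n = y n + Φ n * a n :=
    fun x => Set.ext_iff.1 hν_ball x
  rw [hR]
  refine IsLUB.csSup_eq ⟨?_, ?_⟩ ⟨0, 0, (hball 0).2 ⟨0, 0, by simp, by simp, by simp⟩, by simp⟩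
  · rintro s ⟨x, hx, rfl⟩
    obtain ⟨y, a, hy, ha, hxy⟩ := (hball x).1 hx
    rw [hpair x y a hxy]
    exact add_le_add
      ((lp_tsum_mul_le f y).trans (mul_le_of_le_one_right (norm_nonneg _) hy))
      ((real_inner_le_norm g a).trans (mul_le_of_le_one_right (norm_nonneg _) ha))
  · intro b hb
    rw [← le_sub_iff_add_le]
    refine lp.norm_le_of_forall_le' _ fun n => ?_
    rw [le_sub_iff_add_le]
    set a : lp (fun _ : ℕ => ℝ) 2 := ‖g‖⁻¹ • g
    have ha : ‖a‖ ≤ 1 := by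
      rw [norm_smul, norm_inv, norm_norm]
      exact inv_mul_le_one
    have hga : inner ℝ g a = ‖g‖ := by
      rw [real_inner_smul_right, real_inner_self_eq_norm_sq]
      rcases eq_or_ne ‖g‖ 0 with h | h
      · simp [h]
      · field_simp
    set y : lp (fun _ : ℕ => ℝ) 1 := lp.single 1 n (SignType.sign (f n) : ℝ)
    have hy : ‖y‖ ≤ 1 := by
      rw [lp.norm_single (by simp)]
      rcases lt_trichotomy (f n) 0 with h | h | h <;> simp [h]
    have hfy : ∑' k, f k * y k = |f n| := by
      rw [tsum_eq_single n fun k hk => by simp [y, hk]]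
      simp [y]
    set w : lp (fun _ : ℕ => ℝ) 1 := ⟨fun k => Φ k * a k,
      memℓp_one_mul_of_bounded hΦabs (lp_abs_apply_le_norm (by simp) a)⟩
    have hyw : ∀ k, (y + w) k = y k + Φ k * a k := fun k => rfl
    refine hb ⟨y + w, (hball _).2 ⟨y, a, hy, ha, hyw⟩, ?_⟩
    rw [hpair _ y a hyw, hfy, hga, Real.norm_eq_abs]
end

section
/- Let Φ : ℕ → ℝ satisfy Φ(n) > 0 for all n and Φ summable. Define N : ℓ∞ → ℝ by N(f) = ‖f‖_∞ + (∑_n (Φ(n)·f(n))²)^{1/2}. Then N is a strictly convex norm on ℓ∞: for any two linearly independent f, g ∈ ℓ∞ one has N(f + g) < N(f) + N(g). -/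
open scoped ENNReal

theorem memℓp_two_mul_of_summable {Φ : ℕ → ℝ} (hΦ : Summable Φ)
    (f : lp (fun _ : ℕ => ℝ) ∞) : Memℓp (fun n => Φ n * f n) 2 := by
  refine Memℓp.of_exponent_ge (q := 1) (memℓp_gen ?_) (by norm_num)
  simp only [ENNReal.toReal_one, Real.rpow_one, norm_mul]
  exact Summable.of_nonneg_of_le (fun n => by positivity)
    (fun n => mul_le_mul_of_nonneg_left (lp.norm_apply_le_norm ENNReal.top_ne_zero f n)
      (norm_nonneg _)) (hΦ.norm.mul_right ‖f‖)

/-- Multiplication by a summable sequence, as a linear map from `ℓ∞` to `ℓ²`. -/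
noncomputable def lpMulOfSummable (Φ : ℕ → ℝ) (hΦ : Summable Φ) :
    lp (fun _ : ℕ => ℝ) ∞ →ₗ[ℝ] lp (fun _ : ℕ => ℝ) 2 where
  toFun f := ⟨fun n => Φ n * f n, memℓp_two_mul_of_summable hΦ f⟩
  map_add' f g := by
    ext n
    exact mul_add (Φ n) (f n) (g n)
  map_smul' c f := by
    ext n
    exact mul_left_comm (Φ n) c (f n)

theorem lpMulOfSummable_apply {Φ : ℕ → ℝ} (hΦ : Summable Φ) (f : lp (fun _ : ℕ => ℝ) ∞) (n : ℕ) :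
    lpMulOfSummable Φ hΦ f n = Φ n * f n := rfl

theorem norm_lpMulOfSummable {Φ : ℕ → ℝ} (hΦ : Summable Φ) (f : lp (fun _ : ℕ => ℝ) ∞) :
    ‖lpMulOfSummable Φ hΦ f‖ = √(∑' n, (Φ n * f n) ^ 2) := by
  rw [lp.norm_eq_tsum_rpow (by norm_num), Real.sqrt_eq_rpow]
  simp [lpMulOfSummable_apply, mul_pow]

theorem lpMulOfSummable_injective {Φ : ℕ → ℝ} (hΦ : Summable Φ) (hne : ∀ n, Φ n ≠ 0) :
    Function.Injective (lpMulOfSummable Φ hΦ) := by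
  intro f g h
  ext n
  exact mul_left_cancel₀ (hne n) (congrArg (fun u : lp (fun _ : ℕ => ℝ) 2 => u n) h)

/-- For `Φ : ℕ → ℝ` positive and summable, the map
`N(f) = ‖f‖_∞ + (∑ (Φ(n) f(n))²)^{1/2}` is a strictly convex norm on `ℓ∞`: it is a norm, and
`N(f + g) < N(f) + N(g)` whenever `f, g` are linearly independent. -/
theorem statement14 (Φ : ℕ → ℝ) (hΦpos : ∀ n, 0 < Φ n) (hΦsum : Summable Φ)
    (N : lp (fun _ : ℕ => ℝ) ∞ → ℝ)
    (hN : ∀ f : lp (fun _ : ℕ => ℝ) ∞, N f = ‖f‖ + Real.sqrt (∑' n, (Φ n * f n) ^ 2)) :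
    (∀ f g : lp (fun _ : ℕ => ℝ) ∞, N (f + g) ≤ N f + N g) ∧
    (∀ (c : ℝ) (f : lp (fun _ : ℕ => ℝ) ∞), N (c • f) = |c| * N f) ∧
    (∀ f : lp (fun _ : ℕ => ℝ) ∞, N f = 0 → f = 0) ∧
    (∀ f g : lp (fun _ : ℕ => ℝ) ∞, LinearIndependent ℝ ![f, g] → N (f + g) < N f + N g) := by
  have hN' (f : lp (fun _ : ℕ => ℝ) ∞) : N f = ‖f‖ + ‖lpMulOfSummable Φ hΦsum f‖ := by
    rw [hN, norm_lpMulOfSummable]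
  have hinj := lpMulOfSummable_injective hΦsum fun n => (hΦpos n).ne'
  refine ⟨fun f g => ?_, fun c f => ?_, fun f hf => ?_, fun f g hfg => ?_⟩
  · simp only [hN', map_add]
    linarith [norm_add_le f g,
      norm_add_le (lpMulOfSummable Φ hΦsum f) (lpMulOfSummable Φ hΦsum g)]
  · simp only [hN', map_smul, norm_smul, Real.norm_eq_abs, mul_add]
  · rw [hN'] at hf
    exact norm_le_zero_iff.1 (by linarith [norm_nonneg (lpMulOfSummable Φ hΦsum f)])
  · have hray : ¬SameRay ℝ f g := fun h =>
      sameRay_or_sameRay_neg_iff_not_linearIndependent.1 (Or.inl h) hfg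
    have hlt := norm_add_lt_of_not_sameRay (mt (hinj.sameRay_map_iff).1 hray)
    simp only [hN', map_add]
    linarith [norm_add_le f g]
end

section
/- Let Φ : ℕ → ℝ satisfy Φ(n) > 0 for all n, Φ summable, and ∑_n Φ(n) < 1, and let S_Φ : ℓ₂ → ℓ₁ be the diagonal operator (S_Φ a)(n) = Φ(n)·a(n). Let ν be a norm on ℓ₁ whose closed unit ball equals {y + S_Φ(a) : ‖y‖₁ ≤ 1, ‖a‖₂ ≤ 1}. Suppose x ∈ ℓ₁ and f ∈ ℓ∞ satisfy sup{ ∑_k f(k)·y(k) : y ∈ ℓ₁, ν(y) ≤ 1 } = 1 and ∑_k f(k)·x(k) = ν(x), and let n ∈ ℕ be such that |x(n)| > Φ(n)·ν(x). Then f(n) = sign(x(n))·‖f‖_∞. -/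
open scoped ENNReal

theorem lp.summable_norm_of_one (z : lp (fun _ : ℕ => ℝ) 1) : Summable fun k => ‖z k‖ := by
  simpa using (lp.memℓp z).summable (by simp)

theorem lp.summable_pairing (f : lp (fun _ : ℕ => ℝ) ∞) (z : lp (fun _ : ℕ => ℝ) 1) :
    Summable fun k => f k * z k := by
  refine Summable.of_norm_bounded ((lp.summable_norm_of_one z).mul_left ‖f‖) fun k => ?_
  rw [norm_mul]
  gcongr
  exact lp.norm_apply_le_norm (by simp) f k

theorem lp.norm_sub_single_of_one (y : lp (fun _ : ℕ => ℝ) 1) (n : ℕ) :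
    ‖y - lp.single 1 n (y n)‖ = ‖y‖ - |y n| := by
  have h := lp.norm_compl_sum_single (E := fun _ : ℕ => ℝ) (p := 1) (by simp) y {n}
  simpa using h

theorem lp.tsum_mul_single_one (f : lp (fun _ : ℕ => ℝ) ∞) (k : ℕ) (c : ℝ) :
    ∑' i, f i * (lp.single 1 k c : lp (fun _ : ℕ => ℝ) 1) i = f k * c := by
  rw [tsum_eq_single k]
  · simp
  · intro i hi
    simp [hi]

/-- Let `ν` be a norm on `ℓ₁` whose closed unit ball is `B_{ℓ₁} + S_Φ(B_{ℓ₂})`, for `Φ`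
positive summable with `∑ Φ < 1`. If `x ∈ ℓ₁` and `f ∈ ℓ∞` satisfy `ν*(f) = 1` and
`⟨f, x⟩ = ν(x)`, and `|x(n)| > Φ(n)·ν(x)`, then `f(n) = sign(x(n))·‖f‖_∞`. -/
theorem statement15 (Φ : ℕ → ℝ) (hΦpos : ∀ n, 0 < Φ n) (hΦsum : Summable Φ)
    (hΦlt : ∑' n, Φ n < 1)
    (ν : lp (fun _ : ℕ => ℝ) 1 → ℝ)
    (hν_add : ∀ x y : lp (fun _ : ℕ => ℝ) 1, ν (x + y) ≤ ν x + ν y)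
    (hν_smul : ∀ (c : ℝ) (x : lp (fun _ : ℕ => ℝ) 1), ν (c • x) = |c| * ν x)
    (hν_def : ∀ x : lp (fun _ : ℕ => ℝ) 1, ν x = 0 → x = 0)
    (hν_ball : {x : lp (fun _ : ℕ => ℝ) 1 | ν x ≤ 1} =
      {x : lp (fun _ : ℕ => ℝ) 1 |
        ∃ (y : lp (fun _ : ℕ => ℝ) 1) (a : lp (fun _ : ℕ => ℝ) 2),
          ‖y‖ ≤ 1 ∧ ‖a‖ ≤ 1 ∧ ∀ n : ℕ, x n = y n + Φ n * a n})
    (x : lp (fun _ : ℕ => ℝ) 1) (f : lp (fun _ : ℕ => ℝ) ∞)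
    (hf_dual : sSup {s : ℝ | ∃ y : lp (fun _ : ℕ => ℝ) 1, ν y ≤ 1 ∧ s = ∑' k, f k * y k} = 1)
    (hfx : ∑' k, f k * x k = ν x)
    (n : ℕ) (hn : |x n| > Φ n * ν x) :
    f n = Real.sign (x n) * ‖f‖ := by
  have hν_zero : ν 0 = 0 := by simpa using hν_smul 0 0
  have hν_nonneg : 0 ≤ ν x := by
    have h := hν_add x ((-1 : ℝ) • x)
    have hneg := hν_smul (-1) x
    simp only [neg_smul, one_smul, add_neg_cancel, abs_neg, abs_one, one_mul] at h hneg
    linarith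
  have hν_pos : 0 < ν x := by
    refine lt_of_le_of_ne hν_nonneg fun h => ?_
    simp [hν_def x h.symm, hν_zero] at hn
  have hf_le : ∀ z, ν z ≤ 1 → ∑' k, f k * z k ≤ 1 := by
    intro z hz
    rw [← hf_dual]
    refine le_csSup ?_ ⟨z, hz, rfl⟩
    by_contra h
    rw [Real.sSup_of_not_bddAbove h] at hf_dual
    exact zero_ne_one hf_dual
  set u := (ν x)⁻¹ • x with hu
  have hu_apply : ∀ k, u k = (ν x)⁻¹ * x k := fun k => rfl
  have hνu : ν u ≤ 1 := by
    rw [hu, hν_smul, abs_of_pos (inv_pos.2 hν_pos), inv_mul_cancel₀ hν_pos.ne']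
  have hfu : ∑' k, f k * u k = 1 := by
    simp only [hu_apply, mul_left_comm (f _)]
    rw [tsum_mul_left, hfx, inv_mul_cancel₀ hν_pos.ne']
  obtain ⟨y, a, hy, ha, hya⟩ := hν_ball.subset hνu
  have hswap : ∀ k c, |c| ≤ |y n| → f k * c ≤ f n * y n := by
    intro k c hc
    have hball : ν (u + (lp.single 1 k c - lp.single 1 n (y n))) ≤ 1 := by
      refine hν_ball.superset
        ⟨y + (lp.single 1 k c - lp.single 1 n (y n)), a, ?_, ha, fun i => ?_⟩
      · calc ‖y + (lp.single 1 k c - lp.single 1 n (y n))‖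
            = ‖(y - lp.single 1 n (y n)) + lp.single 1 k c‖ := by congr 1; abel
          _ ≤ ‖y - lp.single 1 n (y n)‖ + ‖(lp.single 1 k c : lp (fun _ : ℕ => ℝ) 1)‖ :=
            norm_add_le _ _
          _ ≤ 1 := by
            rw [lp.norm_sub_single_of_one, lp.norm_single (by simp), Real.norm_eq_abs]
            linarith
      · simp only [lp.coeFn_add, Pi.add_apply, hya i]
        ring
    have h := hf_le _ hball
    simp only [lp.coeFn_add, lp.coeFn_sub, Pi.add_apply, Pi.sub_apply, mul_add, mul_sub] at h
    rw [(lp.summable_pairing f u).tsum_add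
        ((lp.summable_pairing f _).sub (lp.summable_pairing f _)),
      (lp.summable_pairing f _).tsum_sub (lp.summable_pairing f _), hfu,
      lp.tsum_mul_single_one, lp.tsum_mul_single_one] at h
    linarith
  have han : |Φ n * a n| ≤ Φ n := by
    rw [abs_mul, abs_of_pos (hΦpos n)]
    exact mul_le_of_le_one_right (hΦpos n).le
      ((lp.norm_apply_le_norm (by simp) a n).trans ha)
  have hxn : x n = ν x * (y n + Φ n * a n) := by
    rw [← hya n, hu_apply, mul_inv_cancel_left₀ hν_pos.ne']
  have hyn : Φ n < |y n + Φ n * a n| := by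
    rw [hxn, abs_mul, abs_of_pos hν_pos, mul_comm (Φ n) (ν x)] at hn
    exact lt_of_mul_lt_mul_left hn hν_nonneg
  obtain ⟨han₁, han₂⟩ := abs_le.1 han
  have hfn : |f n| ≤ ‖f‖ := lp.norm_apply_le_norm (by simp) f n
  have hy_ne : y n ≠ 0 := by
    intro h
    rw [h, zero_add] at hyn
    linarith
  have hnorm : ‖f‖ ≤ f n * y n / |y n| := by
    have hle : ∀ k, ‖f k‖ ≤ f n * y n / |y n| := by
      intro k
      rw [le_div_iff₀ (abs_pos.2 hy_ne), Real.norm_eq_abs]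
      rcases abs_cases (f k) with ⟨h, -⟩ | ⟨h, -⟩ <;> rw [h]
      · exact hswap k _ (abs_abs _).le
      · simpa using hswap k (-|y n|) (by simp)
    exact lp.norm_le_of_forall_le ((norm_nonneg _).trans (hle 0)) hle
  obtain ⟨hfn₁, hfn₂⟩ := abs_le.1 hfn
  rcases lt_abs.1 hyn with h | h
  · have hy_pos : 0 < y n := by linarith
    have hx_pos : 0 < x n := hxn ▸ mul_pos hν_pos ((hΦpos n).trans h)
    rw [abs_of_pos hy_pos, mul_div_cancel_right₀ _ hy_ne] at hnorm
    rw [Real.sign_of_pos hx_pos]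
    linarith
  · have hy_neg : y n < 0 := by linarith
    have hx_neg : x n < 0 :=
      hxn ▸ mul_neg_of_pos_of_neg hν_pos (by linarith [hΦpos n])
    rw [abs_of_neg hy_neg, div_neg, mul_div_cancel_right₀ _ hy_ne] at hnorm
    rw [Real.sign_of_neg hx_neg]
    linarith
end

section
/- Let X be a real Banach space and let Y be a linear subspace of X that is a separable operator range: Y is separable in the norm of X and there exist an infinite-dimensional real Banach space E and an injective bounded linear operator T₀ : E → X whose range is exactly Y. Then there exists an injective bounded linear operator T : ℓ₁(ℕ×ℕ) → X with ‖T‖ = 1 whose range is contained in Y, such that for every m ∈ ℕ the set { T(e_{n,m}) / ‖T(e_{n,m})‖ : n ∈ ℕ } is dense in S_Y = { y ∈ Y : ‖y‖ = 1 }, where e_{n,m} denotes the canonical unit vector of ℓ₁(ℕ×ℕ) supported at (n, m). -/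
open Topology

/-- In an infinite-dimensional normed space, no finite-dimensional subspace contains a
nonempty open set. -/
theorem exists_mem_open_notMem_of_finiteDimensional {E : Type*} [NormedAddCommGroup E]
    [NormedSpace ℝ E] (hE : ¬ FiniteDimensional ℝ E) (p : Submodule ℝ E) [FiniteDimensional ℝ p]
    {U : Set E} (hU : IsOpen U) (hne : U.Nonempty) : ∃ x ∈ U, x ∉ p := by
  by_contra! h
  have hp : p = ⊤ := p.eq_top_of_nonempty_interior'
    (hne.mono (interior_maximal h hU))
  subst hp
  exact hE (LinearEquiv.finiteDimensional (Submodule.topEquiv (R := ℝ) (M := E)))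

/-- A vector outside a closed subspace is separated from it by a continuous functional. -/
theorem exists_dual_eq_one_of_notMem {E : Type*} [NormedAddCommGroup E] [NormedSpace ℝ E]
    (p : Submodule ℝ E) (hp : IsClosed (p : Set E)) {x : E} (hx : x ∉ p) :
    ∃ f : E →L[ℝ] ℝ, f x = 1 ∧ ∀ y ∈ p, f y = 0 := by
  have hx' : p.mkQ x ≠ 0 := by simpa using hx
  obtain ⟨g, hg⟩ := SeparatingDual.exists_eq_one (R := ℝ) hx'
  refine ⟨g.comp p.mkQL, hg, fun y hy => ?_⟩
  have : p.mkQ y = 0 := by simpa using hy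
  change g (p.mkQ y) = 0
  rw [this, map_zero]

/-- Nonempty open sets of an infinite-dimensional normed space contain the terms of a sequence
admitting a triangular system of continuous functionals. -/
theorem exists_seq_mem_open_triangular {E : Type*} [NormedAddCommGroup E] [NormedSpace ℝ E]
    (hE : ¬ FiniteDimensional ℝ E) (U : ℕ → Set E) (hU : ∀ k, IsOpen (U k))
    (hne : ∀ k, (U k).Nonempty) :
    ∃ (u : ℕ → E) (f : ℕ → E →L[ℝ] ℝ), (∀ k, u k ∈ U k) ∧ (∀ n, f n (u n) = 1) ∧
      ∀ n k, k < n → f n (u k) = 0 := by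
  have step : ∀ (n : ℕ) (p : {p : Submodule ℝ E // FiniteDimensional ℝ p}),
      ∃ x ∈ U n, x ∉ p.1 := fun n p =>
    haveI := p.2
    exists_mem_open_notMem_of_finiteDimensional hE p.1 (hU n) (hne n)
  choose x hxU hxp using step
  let P : ℕ → {p : Submodule ℝ E // FiniteDimensional ℝ p} := fun n =>
    Nat.rec ⟨⊥, inferInstance⟩ (fun n p => ⟨p.1 ⊔ Submodule.span ℝ {x n p},
      haveI := p.2
      inferInstance⟩) n
  have hP : ∀ n, (P (n + 1)).1 = (P n).1 ⊔ Submodule.span ℝ {x n (P n)} := fun n => rfl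
  have hmono : Monotone fun n => (P n).1 :=
    monotone_nat_of_le_succ fun n => by rw [hP]; exact le_sup_left
  have hmem : ∀ n k, k < n → x k (P k) ∈ (P n).1 := fun n k hk =>
    hmono (Nat.succ_le_of_lt hk) (by
      simp only [Nat.succ_eq_add_one, hP]
      exact Submodule.mem_sup_right (Submodule.mem_span_singleton_self _))
  have hf : ∀ n, ∃ f : E →L[ℝ] ℝ, f (x n (P n)) = 1 ∧ ∀ y ∈ (P n).1, f y = 0 := fun n =>
    haveI := (P n).2
    exists_dual_eq_one_of_notMem _ (Submodule.closed_of_finiteDimensional _) (hxp n (P n))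
  choose f hf1 hf0 using hf
  exact ⟨fun n => x n (P n), f, fun n => hxU _ _, hf1, fun n k hk => hf0 n _ (hmem n k hk)⟩

/-- A sequence with a triangular system of functionals can be rescaled so that no nontrivial
bounded combination of the rescaled vectors sums to zero. -/
theorem exists_scaling_of_triangular {E : Type*} [NormedAddCommGroup E] [NormedSpace ℝ E]
    (u : ℕ → E) (f : ℕ → E →L[ℝ] ℝ) (h1 : ∀ n, f n (u n) = 1)
    (h0 : ∀ n k, k < n → f n (u k) = 0) :
    ∃ c : ℕ → ℝ, (∀ k, 0 < c k) ∧ (∀ k, ‖c k • u k‖ ≤ 1) ∧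
      ∀ (a : ℕ → ℝ), BddAbove (Set.range fun k => |a k|) →
        HasSum (fun k => a k • c k • u k) 0 → ∀ k, a k = 0 := by
  let r : ℕ → ℝ := fun k => 1 + ‖u k‖ + ∑ n ∈ Finset.range k, |f n (u k)|
  have hs0 : ∀ k, 0 ≤ ∑ n ∈ Finset.range k, |f n (u k)| := fun k =>
    Finset.sum_nonneg fun _ _ => abs_nonneg _
  have hr1 : ∀ k, 1 ≤ r k := fun k => by
    have := hs0 k; have := norm_nonneg (u k); simp only [r]; linarith
  have hru : ∀ k, ‖u k‖ ≤ r k := fun k => by have := hs0 k; simp only [r]; linarith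
  have hrf : ∀ n k, n < k → |f n (u k)| ≤ r k := fun n k hk => by
    have := Finset.single_le_sum (f := fun n => |f n (u k)|) (fun _ _ => abs_nonneg _)
      (Finset.mem_range.2 hk)
    have := norm_nonneg (u k); simp only [r]; linarith
  let c : ℕ → ℝ := fun k => ∏ j ∈ Finset.range (k + 1), (4 * r j)⁻¹
  have hrpos : ∀ k, 0 < r k := fun k => one_pos.trans_le (hr1 k)
  have hc : ∀ k, 0 < c k := fun k =>
    Finset.prod_pos fun j _ => by have := hrpos j; positivity
  have hcr : ∀ k, c (k + 1) * r (k + 1) = c k * (1 / 4) := fun k => by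
    have := (hrpos (k + 1)).ne'
    simp only [c]
    rw [Finset.prod_range_succ _ (k + 1)]
    field_simp
  have hcs : ∀ k, c (k + 1) ≤ c k * (1 / 4) := fun k => by
    rw [← hcr]; exact le_mul_of_one_le_right (hc _).le (hr1 _)
  have hcn : ∀ n i, c (n + i) ≤ c n * (1 / 4) ^ i := fun n i => by
    induction i with
    | zero => simp
    | succ i ih =>
      calc c (n + i + 1) ≤ c (n + i) * (1 / 4) := hcs _
        _ ≤ c n * (1 / 4) ^ i * (1 / 4) := by gcongr
        _ = _ := by ring
  have hc1 : ∀ k, c k * r k ≤ 1 := fun k => by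
    cases k with
    | zero =>
      have := (hrpos 0).ne'
      simp only [c, zero_add, Finset.prod_range_one]
      field_simp; norm_num
    | succ k =>
      have h := hcn 0 k
      have h' : c 0 ≤ 1 := by
        simp only [c, zero_add, Finset.prod_range_one]
        exact inv_le_one_of_one_le₀ (by have := hr1 0; linarith)
      have h'' : (1 / 4 : ℝ) ^ k ≤ 1 := pow_le_one₀ (by norm_num) (by norm_num)
      have : c k ≤ 1 := by
        rw [zero_add] at h
        exact h.trans (mul_le_one₀ h' (by positivity) h'')
      rw [hcr]; linarith
  refine ⟨c, hc, fun k => ?_, fun a ha hsum => ?_⟩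
  · rw [norm_smul, Real.norm_of_nonneg (hc k).le]
    exact (mul_le_mul_of_nonneg_left (hru k) (hc k).le).trans (hc1 k)
  set A : ℝ := ⨆ k, |a k|
  have haA : ∀ k, |a k| ≤ A := fun k => le_ciSup ha k
  have hgeo : HasSum (fun i : ℕ => (1 / 4 : ℝ) ^ (i + 1)) (1 / 3) := by
    have h := (hasSum_geometric_of_lt_one (r := (1 / 4 : ℝ)) (by norm_num) (by norm_num)).mul_right
      (1 / 4)
    norm_num at h
    simpa [pow_succ] using h
  have key : ∀ n, |a n| ≤ A / 3 := fun n => by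
    have hn : HasSum (fun k => a k * (c k * f n (u k))) 0 := by
      simpa using (f n).hasSum hsum
    have hhead : ∑ k ∈ Finset.range (n + 1), a k * (c k * f n (u k)) = a n * c n := by
      rw [Finset.sum_range_succ, Finset.sum_eq_zero, h1]
      · ring
      · intro k hk
        rw [h0 n k (Finset.mem_range.1 hk)]; ring
    have htail : HasSum (fun i => a (i + (n + 1)) * (c (i + (n + 1)) * f n (u (i + (n + 1)))))
        (-(a n * c n)) := by
      refine (hasSum_nat_add_iff (f := fun k => a k * (c k * f n (u k))) (n + 1)).2 ?_
      rw [hhead, neg_add_cancel]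
      exact hn
    have hbound : ∀ i, ‖a (i + (n + 1)) * (c (i + (n + 1)) * f n (u (i + (n + 1))))‖ ≤
        (A * c n) * (1 / 4) ^ (i + 1) := fun i => by
      rw [norm_mul, norm_mul, Real.norm_of_nonneg (hc _).le, Real.norm_eq_abs, Real.norm_eq_abs,
        mul_assoc]
      refine mul_le_mul (haA _) ?_ (mul_nonneg (hc _).le (abs_nonneg _))
        ((abs_nonneg _).trans (haA 0))
      calc c (i + (n + 1)) * |f n (u (i + (n + 1)))|
          ≤ c (i + (n + 1)) * r (i + (n + 1)) :=
            mul_le_mul_of_nonneg_left (hrf _ _ (by omega)) (hc _).le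
        _ = c (n + i) * (1 / 4) := by rw [← hcr, show n + i + 1 = i + (n + 1) by ring]
        _ ≤ c n * (1 / 4) ^ i * (1 / 4) := by gcongr; exact hcn n i
        _ = _ := by ring
    have h := htail.norm_le_of_bounded (hgeo.mul_left (A * c n)) hbound
    rw [norm_neg, norm_mul, Real.norm_of_nonneg (hc n).le, Real.norm_eq_abs] at h
    have := hc n
    refine le_of_mul_le_mul_right ?_ this
    linarith
  have hA3 : A ≤ A / 3 := ciSup_le key
  intro k
  have := haA k
  have := abs_nonneg (a k)
  exact abs_eq_zero.1 (by linarith)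

/-- A family in the unit ball of a Banach space is the image of the unit vector basis under a
bounded operator defined on `ℓ₁`. -/
theorem exists_clm_lp_one_hasSum {ι E : Type*} [NormedAddCommGroup E] [NormedSpace ℝ E]
    [CompleteSpace E] (w : ι → E) (hw : ∀ i, ‖w i‖ ≤ 1) :
    ∃ S : lp (fun _ : ι => ℝ) 1 →L[ℝ] E, ∀ a, HasSum (fun i => a i • w i) (S a) := by
  have hle : ∀ (a : lp (fun _ : ι => ℝ) 1) i, ‖a i • w i‖ ≤ ‖a i‖ := fun a i => by
    rw [norm_smul]; exact mul_le_of_le_one_right (norm_nonneg _) (hw i)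
  have hn : ∀ a : lp (fun _ : ι => ℝ) 1, HasSum (fun i => ‖a i‖) ‖a‖ := fun a => by
    simpa using lp.hasSum_norm (p := 1) (by simp) a
  have hs : ∀ a : lp (fun _ : ι => ℝ) 1, Summable (fun i => a i • w i) := fun a =>
    (hn a).summable.of_norm_bounded (hle a)
  refine ⟨LinearMap.mkContinuous
    { toFun := fun a => ∑' i, a i • w i
      map_add' := fun a b => ?_
      map_smul' := fun t a => ?_ } 1 fun a => ?_, fun a => (hs a).hasSum⟩
  · rw [← (hs a).tsum_add (hs b)]
    simp [add_smul]
  · rw [RingHom.id_apply, ← (hs a).tsum_const_smul]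
    simp [mul_smul]
  · rw [one_mul]
    exact (hs a).hasSum.norm_le_of_bounded (hn a) (hle a)


/-- If `Y` is a separable operator range in a real Banach space `X` (the injective image of
an infinite-dimensional Banach space `E`), then there is an injective norm-one bounded
operator `T : ℓ₁(ℕ×ℕ) → X` with range inside `Y` such that for every `m`, the normalized
vectors `T(e_{n,m})/‖T(e_{n,m})‖`, `n ∈ ℕ`, are dense in the unit sphere of `Y`. -/
theorem statement16 (X : Type*) [NormedAddCommGroup X] [NormedSpace ℝ X] [CompleteSpace X]
    (Y : Submodule ℝ X) (hYsep : TopologicalSpace.IsSeparable (Y : Set X))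
    (E : Type*) [NormedAddCommGroup E] [NormedSpace ℝ E] [CompleteSpace E]
    (hE : ¬ FiniteDimensional ℝ E)
    (T₀ : E →L[ℝ] X) (hT₀inj : Function.Injective T₀)
    (hT₀range : Set.range T₀ = (Y : Set X)) :
    ∃ T : lp (fun _ : ℕ × ℕ => ℝ) 1 →L[ℝ] X,
      Function.Injective T ∧ ‖T‖ = 1 ∧ Set.range T ⊆ (Y : Set X) ∧
      ∀ m : ℕ,
        {y : X | y ∈ Y ∧ ‖y‖ = 1} ⊆
          closure {w : X | ∃ n : ℕ,
            w = ‖T (lp.single 1 ((n, m) : ℕ × ℕ) (1 : ℝ))‖⁻¹ •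
                T (lp.single 1 ((n, m) : ℕ × ℕ) (1 : ℝ))} := by
  have : TopologicalSpace.SeparableSpace Y := hYsep.separableSpace
  let d : ℕ → Y := TopologicalSpace.denseSeq Y
  have hd : DenseRange d := TopologicalSpace.denseRange_denseSeq Y
  let e : ℕ × ℕ ≃ ℕ := Nat.pairEquiv
  let U : ℕ → Set E := fun k =>
    T₀ ⁻¹' Metric.ball (d (e.symm (e.symm k).1).1 : X) (1 / ((e.symm (e.symm k).1).2 + 1 : ℝ))
  have hU : ∀ k, IsOpen (U k) := fun k => Metric.isOpen_ball.preimage T₀.continuous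
  have hUne : ∀ k, (U k).Nonempty := fun k => by
    obtain ⟨z, hz⟩ : (d (e.symm (e.symm k).1).1 : X) ∈ Set.range T₀ := by
      rw [hT₀range]; exact Subtype.property _
    refine ⟨z, ?_⟩
    simp only [U, Set.mem_preimage, hz]
    exact Metric.mem_ball_self (by positivity)
  obtain ⟨u, f, huU, h1, h0⟩ := exists_seq_mem_open_triangular hE U hU hUne
  obtain ⟨c, hc, hcu, hinj⟩ := exists_scaling_of_triangular u f h1 h0
  obtain ⟨S, hS⟩ := exists_clm_lp_one_hasSum (fun i : ℕ × ℕ => c (e i) • u (e i))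
    (fun i => hcu (e i))
  have hSinj : Function.Injective S := by
    rw [injective_iff_map_eq_zero]
    intro a ha
    have hsum := hS a
    rw [ha, ← e.symm.hasSum_iff] at hsum
    have hz := hinj (fun k => a (e.symm k))
      ⟨‖a‖, by
        rintro _ ⟨k, rfl⟩
        exact lp.norm_apply_le_norm one_ne_zero a (e.symm k)⟩
      (by simpa [Function.comp_def] using hsum)
    ext i
    simpa using hz (e i)
  have hSsingle : ∀ i : ℕ × ℕ, S (lp.single 1 i (1 : ℝ)) = c (e i) • u (e i) := fun i => by
    refine (hS _).unique ?_
    convert hasSum_ite_eq i (c (e i) • u (e i)) using 2 with j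
    by_cases h : j = i
    · subst h; simp
    · simp [h]
  let T₁ : lp (fun _ : ℕ × ℕ => ℝ) 1 →L[ℝ] X := T₀.comp S
  have hT₁inj : Function.Injective T₁ := hT₀inj.comp hSinj
  have hT₁ : 0 < ‖T₁‖ := by
    rw [norm_pos_iff]
    intro h
    have hs : (lp.single 1 ((0, 0) : ℕ × ℕ) (1 : ℝ) : lp (fun _ : ℕ × ℕ => ℝ) 1) = 0 :=
      hT₁inj (by simp [h])
    have := lp.norm_single (E := fun _ : ℕ × ℕ => ℝ) (p := 1) one_pos (0, 0) (1 : ℝ)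
    rw [hs] at this
    simp at this
  refine ⟨‖T₁‖⁻¹ • T₁, ?_, ?_, ?_, ?_⟩
  · intro a b hab
    exact hT₁inj (smul_right_injective X (inv_ne_zero hT₁.ne') hab)
  · rw [norm_smul, norm_inv, norm_norm, inv_mul_cancel₀ hT₁.ne']
  · rintro _ ⟨a, rfl⟩
    refine Y.smul_mem _ ?_
    change T₀ (S a) ∈ (Y : Set X)
    rw [← hT₀range]
    exact Set.mem_range_self _
  · rintro m y ⟨hyY, hy1⟩
    have hnormal : ∀ n, ‖(‖T₁‖⁻¹ • T₁) (lp.single 1 ((n, m) : ℕ × ℕ) (1 : ℝ))‖⁻¹ •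
        (‖T₁‖⁻¹ • T₁) (lp.single 1 ((n, m) : ℕ × ℕ) (1 : ℝ)) =
        ‖T₀ (u (e (n, m)))‖⁻¹ • T₀ (u (e (n, m))) := fun n => by
      have hpos : 0 < ‖T₁‖⁻¹ * c (e (n, m)) := mul_pos (inv_pos.2 hT₁) (hc _)
      have : (‖T₁‖⁻¹ • T₁) (lp.single 1 ((n, m) : ℕ × ℕ) (1 : ℝ)) =
          (‖T₁‖⁻¹ * c (e (n, m))) • T₀ (u (e (n, m))) := by
        change ‖T₁‖⁻¹ • T₀ (S _) = _
        rw [hSsingle, map_smul, smul_smul]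
      rw [this, norm_smul, Real.norm_of_nonneg hpos.le, smul_smul, mul_inv,
        mul_right_comm, inv_mul_cancel₀ hpos.ne', one_mul]
    have hycl : y ∈ closure (Set.range fun n => T₀ (u (e (n, m)))) := by
      rw [Metric.mem_closure_range_iff]
      intro ε hε
      obtain ⟨i, hi⟩ := hd.exists_dist_lt (⟨y, hyY⟩ : Y) (half_pos hε)
      obtain ⟨j, hj⟩ := exists_nat_one_div_lt (half_pos hε)
      refine ⟨e (i, j), ?_⟩
      have hmem := huU (e (e (i, j), m))
      simp only [U, Equiv.symm_apply_apply, Set.mem_preimage, Metric.mem_ball] at hmem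
      have hi' : dist y (d i : X) < ε / 2 := hi
      have := dist_triangle_right y (T₀ (u (e (e (i, j), m)))) (d i : X)
      linarith
    have hcont : ContinuousAt (fun x : X => ‖x‖⁻¹ • x) y :=
      (continuousAt_id.norm.inv₀ (by simp [hy1])).smul continuousAt_id
    have := mem_closure_image hcont hycl
    simp only [hy1, inv_one, one_smul] at this
    refine closure_mono ?_ this
    rintro _ ⟨_, ⟨n, rfl⟩, rfl⟩
    exact ⟨n, (hnormal n).symm⟩
end

section
/- Let Z be a real normed space that is smooth, i.e., for every z ∈ Z with ‖z‖ = 1 there is at most one continuous linear functional f on Z with ‖f‖ = 1 and f(z) = 1. Let f₁, f₂ be linearly independent continuous linear functionals on Z with ‖f₁‖ = ‖f₂‖ = 1, let 0 < t < 1, and suppose ‖t·f₁ + (1−t)·f₂‖ = 1. Then t·f₁ + (1−t)·f₂ is not norm-attaining: there is no z ∈ Z with ‖z‖ = 1 and |(t·f₁ + (1−t)·f₂)(z)| = 1. -/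
/-- In a smooth real normed space `Z`, if `f₁, f₂` are linearly independent norm-one
functionals, `0 < t < 1`, and `‖t • f₁ + (1 - t) • f₂‖ = 1`, then `t • f₁ + (1 - t) • f₂`
does not attain its norm. -/
theorem statement19 (Z : Type*) [NormedAddCommGroup Z] [NormedSpace ℝ Z]
    (hsmooth : ∀ z : Z, ‖z‖ = 1 →
      ∀ f g : Z →L[ℝ] ℝ, ‖f‖ = 1 → f z = 1 → ‖g‖ = 1 → g z = 1 → f = g)
    (f₁ f₂ : Z →L[ℝ] ℝ) (hind : LinearIndependent ℝ ![f₁, f₂])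
    (hf₁ : ‖f₁‖ = 1) (hf₂ : ‖f₂‖ = 1)
    (t : ℝ) (ht₀ : 0 < t) (ht₁ : t < 1)
    (hnorm : ‖t • f₁ + (1 - t) • f₂‖ = 1) :
    ¬ ∃ z : Z, ‖z‖ = 1 ∧ |(t • f₁ + (1 - t) • f₂) z| = 1 := by
  rintro ⟨z, hz, hz'⟩
  have hpos : ∀ w : Z, ‖w‖ = 1 → (t • f₁ + (1 - t) • f₂) w = 1 → False := by
    intro w hw h
    have h₁ : f₁ w ≤ 1 := by
      simpa [hf₁, hw] using (le_abs_self _).trans (f₁.le_opNorm w)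
    have h₂ : f₂ w ≤ 1 := by
      simpa [hf₂, hw] using (le_abs_self _).trans (f₂.le_opNorm w)
    simp only [add_apply, smul_apply,
      smul_eq_mul] at h
    have e₁ : f₁ w = 1 := by nlinarith
    have e₂ : f₂ w = 1 := by nlinarith
    have h01 : (0 : Fin 2) = 1 := hind.injective (hsmooth w hw f₁ f₂ hf₁ e₁ hf₂ e₂)
    exact zero_ne_one h01
  rcases eq_or_eq_neg_of_abs_eq hz' with h | h
  · exact hpos z hz h
  · exact hpos (-z) (by rwa [norm_neg]) (by rw [map_neg, h, neg_neg])
end
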